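/- Suppose x₀ = y₀. Then for every r > 0 there exists ε₀ > 0 such that for all ε ∈ (0, ε₀), every critical point x ∈ Ω_ε of u_ε (i.e. every x ∈ Ω_ε with ∇u_ε(x) = 0) satisfies |x − x₀| < r. -/

import Mathlib

open Real Set Metric Filter Topology

noncomputable section

abbrev E2 := EuclideanSpace ℝ (Fin 2)

/-- Second partial derivative `∂²u/∂xᵢ∂xⱼ` at `x`. -/
noncomputable def pd2 (u : E2 → ℝ) (x : E2) (i j : Fin 2) : ℝ :=
  fderiv ℝ (fun y => fderiv ℝ u y (EuclideanSpace.single j 1)) x (EuclideanSpace.single i 1)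

/-- The Hessian matrix `D²u(x)`. -/
noncomputable def Hess (u : E2 → ℝ) (x : E2) : Matrix (Fin 2) (Fin 2) ℝ :=
  Matrix.of fun i j => pd2 u x i j

/-- The Laplacian `Δu(x)`. -/
noncomputable def lap (u : E2 → ℝ) (x : E2) : ℝ := pd2 u x 0 0 + pd2 u x 1 1

/-- The largest eigenvalue of a symmetric 2×2 real matrix. -/
noncomputable def lambdaMax (M : Matrix (Fin 2) (Fin 2) ℝ) : ℝ :=
  ((M 0 0 + M 1 1) + Real.sqrt ((M 0 0 - M 1 1) ^ 2 + (M 0 1 + M 1 0) ^ 2)) / 2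

/-- `u` is the torsion function of `U`: continuous up to the boundary, `C²` inside,
`Δu = -1` in `U` and `u = 0` on `∂U`. -/
def IsTorsion (U : Set E2) (u : E2 → ℝ) : Prop :=
  ContinuousOn u (closure U) ∧ (∀ x ∈ U, ContDiffAt ℝ 2 u x) ∧
    (∀ x ∈ U, lap u x = -1) ∧ (∀ x ∈ frontier U, u x = 0)

/-- `g` is `C²` at `x` with Laplacian `c` there. -/
def HasLap (g : E2 → ℝ) (x : E2) (c : ℝ) : Prop :=
  ContDiffAt ℝ 2 g x ∧ Laplacian.laplacian g x = c

lemma HasLap.congr_val {g : E2 → ℝ} {x : E2} {c d : ℝ} (h : HasLap g x c) (hcd : c = d) :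
    HasLap g x d := hcd ▸ h

lemma HasLap.sub {f g : E2 → ℝ} {x : E2} {c d : ℝ} (hf : HasLap f x c) (hg : HasLap g x d) :
    HasLap (fun z => f z - g z) x (c - d) :=
  ⟨hf.1.sub hg.1, by
    have := ContDiffAt.laplacian_sub hf.1 hg.1
    rw [hf.2, hg.2] at this; exact this⟩

lemma HasLap.const_mul {f : E2 → ℝ} {x : E2} {c : ℝ} (k : ℝ) (hf : HasLap f x c) :
    HasLap (fun z => k * f z) x (k * c) :=
  ⟨contDiffAt_const.mul hf.1, by
    have := InnerProductSpace.laplacian_smul k hf.1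
    rw [hf.2] at this; exact this⟩

lemma hasLap_const (k : ℝ) (x : E2) : HasLap (fun _ => k) x 0 :=
  ⟨contDiffAt_const, by rw [InnerProductSpace.laplacian_const]; rfl⟩

lemma laplacian_eq_sum (g : E2 → ℝ) (x : E2) :
    Laplacian.laplacian g x =
      ∑ i : Fin 2, fderiv ℝ (fderiv ℝ g) x (EuclideanSpace.single i 1)
        (EuclideanSpace.single i 1) := by
  rw [InnerProductSpace.laplacian_eq_iteratedFDeriv_orthonormalBasis g
    (EuclideanSpace.basisFun (Fin 2) ℝ)]
  simp [iteratedFDeriv_two_apply]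

lemma ContDiffAt.differentiableAt_fderiv {g : E2 → ℝ} {x : E2} (hg : ContDiffAt ℝ 2 g x) :
    DifferentiableAt ℝ (fderiv ℝ g) x :=
  (hg.fderiv_right (m := 1) (by norm_num)).differentiableAt (by norm_num)

lemma hasLap_lap {u : E2 → ℝ} {x : E2} (hu : ContDiffAt ℝ 2 u x) : HasLap u x (lap u x) := by
  refine ⟨hu, ?_⟩
  rw [laplacian_eq_sum, Fin.sum_univ_two]
  have h (e v : E2) : fderiv ℝ (fun y => fderiv ℝ u y e) x v = fderiv ℝ (fderiv ℝ u) x v e := by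
    rw [fderiv_clm_apply hu.differentiableAt_fderiv (differentiableAt_const e)]
    simp
  simp [lap, pd2, h]

/-- Along a line, a `C²` function has the expected first and second derivatives. -/
lemma line_derivs {g : E2 → ℝ} {x : E2} (hg : ContDiffAt ℝ 2 g x) (e : E2) :
    (∀ᶠ t in 𝓝 (0:ℝ), HasDerivAt (fun t : ℝ => g (x + t • e)) (fderiv ℝ g (x + t • e) e) t) ∧
    HasDerivAt (fun t : ℝ => fderiv ℝ g (x + t • e) e) (fderiv ℝ (fderiv ℝ g) x e e) 0 := by
  have hl (t : ℝ) : HasDerivAt (fun t : ℝ => x + t • e) e t := by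
    simpa using ((hasDerivAt_id t).smul_const e).const_add x
  have hc : Tendsto (fun t : ℝ => x + t • e) (𝓝 0) (𝓝 x) := by
    have := (hl 0).continuousAt.tendsto
    simpa using this
  constructor
  · have h1 : ∀ᶠ y in 𝓝 x, DifferentiableAt ℝ g y := by
      filter_upwards [hg.eventually (by simp)] with y hy
      exact hy.differentiableAt (by norm_num)
    filter_upwards [hc.eventually h1] with t ht
    exact ht.hasFDerivAt.comp_hasDerivAt t (hl t)
  · have h2 : HasFDerivAt (fderiv ℝ g) (fderiv ℝ (fderiv ℝ g) x) (x + (0:ℝ) • e) := by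
      simpa using hg.differentiableAt_fderiv.hasFDerivAt
    have h3 := h2.comp_hasDerivAt 0 (hl 0)
    simpa using h3.clm_apply (hasDerivAt_const 0 e)

lemma hasLap_of_lines {g : E2 → ℝ} {x : E2} (hg : ContDiffAt ℝ 2 g x) {d₀ d₁ : ℝ → ℝ}
    {c₀ c₁ : ℝ}
    (h₀ : ∀ᶠ t in 𝓝 (0:ℝ),
      HasDerivAt (fun t : ℝ => g (x + t • EuclideanSpace.single 0 1)) (d₀ t) t)
    (h₀' : HasDerivAt d₀ c₀ 0)
    (h₁ : ∀ᶠ t in 𝓝 (0:ℝ),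
      HasDerivAt (fun t : ℝ => g (x + t • EuclideanSpace.single 1 1)) (d₁ t) t)
    (h₁' : HasDerivAt d₁ c₁ 0) : HasLap g x (c₀ + c₁) := by
  refine ⟨hg, ?_⟩
  have key (e : E2) (d : ℝ → ℝ) (c : ℝ)
      (h : ∀ᶠ t in 𝓝 (0:ℝ), HasDerivAt (fun t : ℝ => g (x + t • e)) (d t) t)
      (h' : HasDerivAt d c 0) : fderiv ℝ (fderiv ℝ g) x e e = c := by
    obtain ⟨k1, k2⟩ := line_derivs hg e
    have heq : (fun t : ℝ => fderiv ℝ g (x + t • e) e) =ᶠ[𝓝 0] d := by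
      filter_upwards [h, k1] with t ht ht'
      exact ht'.unique ht
    exact k2.unique (h'.congr_of_eventuallyEq heq)
  rw [laplacian_eq_sum, Fin.sum_univ_two, key _ _ _ h₀ h₀', key _ _ _ h₁ h₁']

/-- The Laplacian is nonnegative at a local minimum. -/
lemma HasLap.nonneg_of_isLocalMin {g : E2 → ℝ} {x : E2} {c : ℝ} (h : HasLap g x c)
    (hmin : IsLocalMin g x) : 0 ≤ c := by
  rw [← h.2, laplacian_eq_sum]
  refine Finset.sum_nonneg fun i _ => ?_
  set e : E2 := EuclideanSpace.single i 1
  obtain ⟨k1, k2⟩ := line_derivs h.1 e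
  by_contra! hneg
  have hd : deriv (fun t : ℝ => g (x + t • e)) =ᶠ[𝓝 0] fun t => fderiv ℝ g (x + t • e) e := by
    filter_upwards [k1] with t ht using ht.deriv
  have hdd : deriv (deriv fun t : ℝ => g (x + t • e)) 0 < 0 := by
    rw [hd.deriv_eq, k2.deriv]; exact hneg
  have hc : Tendsto (fun t : ℝ => x + t • e) (𝓝 0) (𝓝 x) := by
    have : Continuous fun t : ℝ => x + t • e := by fun_prop
    simpa using this.tendsto 0
  have hm : IsLocalMin (fun t : ℝ => g (x + t • e)) 0 := by
    have := hc.eventually hmin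
    simpa [IsLocalMin, IsMinFilter] using this
  have hM := isLocalMax_of_deriv_deriv_neg hdd hm.deriv_eq_zero k1.self_of_nhds.continuousAt
  have hconst : (fun t : ℝ => g (x + t • e)) =ᶠ[𝓝 0] fun _ => g (x + (0:ℝ) • e) := by
    filter_upwards [hm, hM] with t h1 h2 using le_antisymm h2 h1
  have : deriv (deriv fun t : ℝ => g (x + t • e)) 0 = 0 := by
    rw [hconst.deriv.deriv_eq]; simp
  linarith

lemma HasLap.comp_isometry {g : E2 → ℝ} {c : ℝ} (L : E2 ≃ₗᵢ[ℝ] E2) (q z : E2)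
    (h : HasLap g (q + L z) c) : HasLap (fun y => g (q + L y)) z c := by
  refine ⟨h.1.comp z (by fun_prop), ?_⟩
  rw [← h.2, InnerProductSpace.laplacian_eq_iteratedFDeriv_orthonormalBasis _
    (EuclideanSpace.basisFun (Fin 2) ℝ),
    InnerProductSpace.laplacian_eq_iteratedFDeriv_orthonormalBasis g
    ((EuclideanSpace.basisFun (Fin 2) ℝ).map L)]
  refine Finset.sum_congr rfl fun i _ => ?_
  have h1 : (fun y => g (q + L y)) = (fun w => g (q + w)) ∘ L := rfl
  have h2 := L.toContinuousLinearEquiv.iteratedFDerivWithin_comp_right (fun w => g (q + w))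
    (s := univ) uniqueDiffOn_univ (x := z) (mem_univ _) 2
  simp only [preimage_univ, iteratedFDerivWithin_univ] at h2
  rw [h1]
  erw [h2]
  rw [iteratedFDeriv_comp_add_left']
  simp only [ContinuousMultilinearMap.compContinuousLinearMap_apply]
  congr 1
  ext j
  fin_cases j <;> simp

/-- Minimum principle for continuous functions with nonpositive Laplacian. -/
lemma min_principle {U : Set E2} (hU : IsOpen U) (hb : Bornology.IsBounded U) {g : E2 → ℝ}
    (hg : ContinuousOn g (closure U)) (hlap : ∀ x ∈ U, ∃ c ≤ 0, HasLap g x c)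
    (hbd : ∀ x ∈ frontier U, 0 ≤ g x) : ∀ x ∈ closure U, 0 ≤ g x := by
  intro x hx
  have hcomp : IsCompact (closure U) := hb.isCompact_closure
  obtain ⟨D, hD⟩ := hcomp.isBounded.subset_closedBall 0
  have hq (z : E2) (hz : z ∈ closure U) : z 0 ^ 2 + z 1 ^ 2 ≤ D ^ 2 := by
    have h1 : ‖z‖ ≤ D := by simpa using hD hz
    have h2 := EuclideanSpace.norm_sq_eq z
    rw [Fin.sum_univ_two] at h2
    simp only [Real.norm_eq_abs, sq_abs] at h2
    rw [← h2]; gcongr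
  have hqlap (z : E2) : HasLap (fun z : E2 => z 0 ^ 2 + z 1 ^ 2) z (2 + 2) := by
    refine hasLap_of_lines (d₀ := fun t => 2 * (z 0 + t)) (d₁ := fun t => 2 * (z 1 + t))
      (by fun_prop) ?_ ?_ ?_ ?_
    · refine Eventually.of_forall fun t => ?_
      have := (((hasDerivAt_id t).const_add (z 0)).pow 2).add_const (z 1 ^ 2)
      simpa using this
    · simpa using ((hasDerivAt_id (0:ℝ)).const_add (z 0)).const_mul 2
    · refine Eventually.of_forall fun t => ?_
      have := (((hasDerivAt_id t).const_add (z 1)).pow 2).const_add (z 0 ^ 2)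
      simpa using this
    · simpa using ((hasDerivAt_id (0:ℝ)).const_add (z 1)).const_mul 2
  refine le_of_forall_pos_lt_add fun η hη => ?_
  set δ := η / (2 * (D ^ 2 + 1)) with hδ
  have hδpos : 0 < δ := by positivity
  have hδD : δ * D ^ 2 < η := by
    rw [hδ, div_mul_eq_mul_div, div_lt_iff₀ (by positivity)]
    nlinarith [sq_nonneg D]
  set G : E2 → ℝ := fun z => g z - δ * (z 0 ^ 2 + z 1 ^ 2) with hG
  have hGc : ContinuousOn G (closure U) := hg.sub (by fun_prop)
  obtain ⟨m, hmU, hm⟩ := hcomp.exists_isMinOn ⟨x, hx⟩ hGc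
  have hmfr : m ∉ U := by
    intro hmU'
    obtain ⟨c, hc, hl⟩ := hlap m hmU'
    have hloc : IsLocalMin G m :=
      (hm.on_subset subset_closure).isLocalMin (hU.mem_nhds hmU')
    have := (hl.sub ((hqlap m).const_mul δ)).nonneg_of_isLocalMin hloc
    linarith
  have h0 : 0 ≤ g m := hbd m ⟨hmU, by rwa [hU.interior_eq]⟩
  have h1 : G m ≤ G x := hm hx
  simp only [hG] at h1
  have h2 := hq m hmU
  have h3 : δ * (m 0 ^ 2 + m 1 ^ 2) ≤ δ * D ^ 2 := by gcongr
  have h4 : 0 ≤ δ * (x 0 ^ 2 + x 1 ^ 2) := by positivity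
  linarith

lemma hasLap_quadratic (k b l c d : ℝ) (x : E2) :
    HasLap (fun z : E2 => k + b * z 0 + l * z 1 + c * z 0 ^ 2 + d * z 1 ^ 2) x
      (2 * c + 2 * d) := by
  refine hasLap_of_lines (d₀ := fun t => b + 2 * c * (x 0 + t))
    (d₁ := fun t => l + 2 * d * (x 1 + t)) (by fun_prop) ?_ ?_ ?_ ?_
  · refine Eventually.of_forall fun t => ?_
    have h := (hasDerivAt_id t).const_add (x 0)
    have := (((((h.const_mul b).const_add k).add_const (l * x 1)).add
      ((h.pow 2).const_mul c))).add_const (d * x 1 ^ 2)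
    convert! this using 1
    · ext t; simp
    · simp; ring
  · simpa using (((hasDerivAt_id (0:ℝ)).const_add (x 0)).const_mul (2 * c)).const_add b
  · refine Eventually.of_forall fun t => ?_
    have h := (hasDerivAt_id t).const_add (x 1)
    have := (((h.const_mul l).const_add (k + b * x 0)).add_const (c * x 0 ^ 2)).add
      ((h.pow 2).const_mul d)
    convert! this using 1
    · ext t; simp
    · simp; ring
  · simpa using (((hasDerivAt_id (0:ℝ)).const_add (x 1)).const_mul (2 * d)).const_add l

lemma hasLap_mul_coord {f f' f'' h h' h'' : ℝ → ℝ} (cf : ContDiff ℝ 2 f) (ch : ContDiff ℝ 2 h)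
    (hf : ∀ t, HasDerivAt f (f' t) t) (hf' : ∀ t, HasDerivAt f' (f'' t) t)
    (hh : ∀ t, HasDerivAt h (h' t) t) (hh' : ∀ t, HasDerivAt h' (h'' t) t) (x : E2) :
    HasLap (fun z : E2 => f (z 0) * h (z 1)) x (f'' (x 0) * h (x 1) + f (x 0) * h'' (x 1)) := by
  refine hasLap_of_lines (d₀ := fun t => f' (x 0 + t) * h (x 1))
    (d₁ := fun t => f (x 0) * h' (x 1 + t)) (by fun_prop) ?_ ?_ ?_ ?_
  · refine Eventually.of_forall fun t => ?_
    simpa using ((hf (x 0 + t)).comp_const_add (x 0) t).mul_const (h (x 1))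
  · simpa using ((hf' (x 0 + 0)).comp_const_add (x 0) 0).mul_const (h (x 1))
  · refine Eventually.of_forall fun t => ?_
    simpa using ((hh (x 1 + t)).comp_const_add (x 1) t).const_mul (f (x 0))
  · simpa using ((hh' (x 1 + 0)).comp_const_add (x 1) 0).const_mul (f (x 0))

lemma coord_sq_pos {x : E2} (hx : x ≠ 0) : 0 < x 0 ^ 2 + x 1 ^ 2 := by
  have := EuclideanSpace.norm_sq_eq x
  simp only [Fin.sum_univ_two, Real.norm_eq_abs, sq_abs] at this
  rw [← this]; positivity

lemma hasLap_log {x : E2} (hx : x ≠ 0) :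
    HasLap (fun z : E2 => Real.log (z 0 ^ 2 + z 1 ^ 2)) x 0 := by
  have hpos := coord_sq_pos hx
  have aux (a b : ℝ) (hab : 0 < a ^ 2 + b ^ 2) :
      (∀ᶠ t in 𝓝 (0:ℝ), HasDerivAt (fun t => Real.log ((a + t) ^ 2 + b ^ 2))
        (2 * (a + t) / ((a + t) ^ 2 + b ^ 2)) t) ∧
      HasDerivAt (fun t => 2 * (a + t) / ((a + t) ^ 2 + b ^ 2))
        (2 * (b ^ 2 - a ^ 2) / (a ^ 2 + b ^ 2) ^ 2) 0 := by
    have h1 (t : ℝ) : HasDerivAt (fun t => (a + t) ^ 2 + b ^ 2) (2 * (a + t)) t := by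
      simpa using (((hasDerivAt_id t).const_add a).pow 2).add_const (b ^ 2)
    constructor
    · have hc : ContinuousAt (fun t : ℝ => (a + t) ^ 2 + b ^ 2) 0 := by fun_prop
      have : ∀ᶠ t in 𝓝 (0:ℝ), 0 < (a + t) ^ 2 + b ^ 2 :=
        hc.eventually (lt_mem_nhds (by simpa using hab))
      filter_upwards [this] with t ht
      exact (h1 t).log ht.ne'
    · have h2 : HasDerivAt (fun t => 2 * (a + t)) 2 0 := by
        simpa using ((hasDerivAt_id (0:ℝ)).const_add a).const_mul 2
      convert! h2.div (h1 0) (by simpa using hab.ne') using 1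
      simp; ring
  obtain ⟨k1, k2⟩ := aux (x 0) (x 1) hpos
  obtain ⟨k3, k4⟩ := aux (x 1) (x 0) (by rwa [add_comm])
  refine (hasLap_of_lines (ContDiffAt.log (by fun_prop) hpos.ne') (by simpa using k1) k2 ?_
    k4).congr_val ?_
  · simpa [add_comm] using k3
  · rw [add_comm (x 1 ^ 2)]; ring

lemma IsTorsion.hasLap {V : Set E2} {u : E2 → ℝ} (h : IsTorsion V u) {x : E2} (hx : x ∈ V) :
    HasLap u x (-1) := (hasLap_lap (h.2.1 x hx)).congr_val (h.2.2.1 x hx)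

lemma IsTorsion.nonneg {V : Set E2} {u : E2 → ℝ} (h : IsTorsion V u) (hV : IsOpen V)
    (hb : Bornology.IsBounded V) {x : E2} (hx : x ∈ closure V) : 0 ≤ u x :=
  min_principle hV hb h.1 (fun _ hx => ⟨-1, by norm_num, h.hasLap hx⟩)
    (fun x hx => (h.2.2.2 x hx).ge) x hx

lemma dist_sq_coord (z c : E2) : dist z c ^ 2 = (z 0 - c 0) ^ 2 + (z 1 - c 1) ^ 2 := by
  rw [dist_eq_norm, EuclideanSpace.norm_sq_eq, Fin.sum_univ_two]
  simp

/-- Comparison with the torsion function of an inscribed disc. -/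
lemma IsTorsion.ge_disc {V : Set E2} {u : E2 → ℝ} (h : IsTorsion V u) (hV : IsOpen V)
    (hb : Bornology.IsBounded V) {c : E2} {R : ℝ} (hR : 0 < R) (hc : ball c R ⊆ V) {z : E2}
    (hz : z ∈ closedBall c R) : (R ^ 2 - dist z c ^ 2) / 4 ≤ u z := by
  have hcl : closedBall c R ⊆ closure V := by
    rw [← closure_ball c hR.ne']; exact closure_mono hc
  have := min_principle (U := ball c R) isOpen_ball isBounded_ball
    (g := fun z => u z - (R ^ 2 - dist z c ^ 2) / 4) ?_ ?_ ?_ z (by rwa [closure_ball c hR.ne'])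
  · linarith
  · rw [closure_ball c hR.ne']
    exact (h.1.mono hcl).sub (by fun_prop)
  · intro x hx
    have k : HasLap (fun z : E2 => (R ^ 2 - dist z c ^ 2) / 4) x (-1) := by
      convert! hasLap_quadratic ((R ^ 2 - c 0 ^ 2 - c 1 ^ 2) / 4)
        (c 0 / 2) (c 1 / 2) (-1 / 4) (-1 / 4) x using 1
      · ext z; rw [dist_sq_coord]; ring
      · norm_num
    exact ⟨_, by norm_num, (h.hasLap (hc hx)).sub k⟩
  · intro x hx
    rw [frontier_ball c hR.ne', mem_sphere] at hx
    have := h.nonneg hV hb (hcl (mem_closedBall.2 hx.le))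
    simp only [hx]; linarith

lemma IsTorsion.pos {V : Set E2} {u : E2 → ℝ} (h : IsTorsion V u) (hV : IsOpen V)
    (hb : Bornology.IsBounded V) {x : E2} (hx : x ∈ V) : 0 < u x := by
  obtain ⟨R, hR, hball⟩ := Metric.isOpen_iff.1 hV x hx
  have := h.ge_disc hV hb hR hball (mem_closedBall_self hR.le)
  simp only [dist_self] at this
  have : 0 < R ^ 2 := by positivity
  linarith

/-- The open box `|x - a| < ρ`, `l < y < s`. -/
def openBox (a ρ l s : ℝ) : Set E2 := {z | |z 0 - a| < ρ ∧ l < z 1 ∧ z 1 < s}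

/-- The closed box `|x - a| ≤ ρ`, `l ≤ y ≤ s`. -/
def closedBox (a ρ l s : ℝ) : Set E2 := {z | |z 0 - a| ≤ ρ ∧ l ≤ z 1 ∧ z 1 ≤ s}

/-- Minimum principle on a box. -/
lemma box_min {a ρ l s : ℝ} {g : E2 → ℝ} (hg : ContinuousOn g (closedBox a ρ l s))
    (hlap : ∀ x ∈ openBox a ρ l s, ∃ c ≤ 0, HasLap g x c)
    (hside : ∀ z ∈ closedBox a ρ l s, |z 0 - a| = ρ → 0 ≤ g z)
    (hbot : ∀ z ∈ closedBox a ρ l s, z 1 = l → 0 ≤ g z)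
    (htop : ∀ z ∈ closedBox a ρ l s, z 1 = s → 0 ≤ g z) :
    ∀ z ∈ openBox a ρ l s, 0 ≤ g z := by
  have e0 : Continuous fun z : E2 => |z 0 - a| := by fun_prop
  have e1 : Continuous fun z : E2 => z 1 := by fun_prop
  have hopen : IsOpen (openBox a ρ l s) := by
    refine IsOpen.inter ?_ (IsOpen.inter ?_ ?_)
    · exact isOpen_lt e0 continuous_const
    · exact isOpen_lt continuous_const e1
    · exact isOpen_lt e1 continuous_const
  have hclosed : IsClosed (closedBox a ρ l s) := by
    refine IsClosed.inter ?_ (IsClosed.inter ?_ ?_)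
    · exact isClosed_le e0 continuous_const
    · exact isClosed_le continuous_const e1
    · exact isClosed_le e1 continuous_const
  have hsub : closure (openBox a ρ l s) ⊆ closedBox a ρ l s :=
    closure_minimal (fun z hz => ⟨hz.1.le, hz.2.1.le, hz.2.2.le⟩) hclosed
  have hbdd : Bornology.IsBounded (openBox a ρ l s) := by
    refine (isBounded_closedBall (x := (!₂[a, l] : E2)) (r := ρ + (s - l))).subset
      fun z hz => ?_
    rw [mem_closedBall]
    have h1 : 0 < ρ := lt_of_le_of_lt (abs_nonneg _) hz.1
    have h2 : l < s := hz.2.1.trans hz.2.2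
    refine abs_le_of_sq_le_sq' ?_ (by linarith) |>.2
    rw [dist_sq_coord]
    simp only [Matrix.cons_val_zero, Matrix.cons_val_one]
    have h3 : (z 0 - a) ^ 2 ≤ ρ ^ 2 := sq_le_sq' (by linarith [(abs_lt.1 hz.1).1])
      (abs_lt.1 hz.1).2.le
    have h4 : (z 1 - l) ^ 2 ≤ (s - l) ^ 2 := by
      have := hz.2.1; have := hz.2.2; gcongr
    nlinarith
  intro z hz
  refine min_principle hopen hbdd (hg.mono hsub) hlap (fun x hx => ?_) z (subset_closure hz)
  have hx1 := hsub hx.1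
  have hx2 : x ∉ openBox a ρ l s := by rw [← hopen.interior_eq]; exact hx.2
  rcases hx1.1.lt_or_eq with h | h
  · rcases hx1.2.1.lt_or_eq with h' | h'
    · rcases hx1.2.2.lt_or_eq with h'' | h''
      · exact absurd ⟨h, h', h''⟩ hx2
      · exact htop x hx1 h''
    · exact hbot x hx1 h'.symm
  · exact hside x hx1 h

/-- A nonnegative harmonic function on a box, positive on the bottom side, grows linearly
away from the midpoint of the top side. -/
lemma hopf_box {a ρ l s m : ℝ} (hρ : 0 < ρ) (hls : l < s) (hm : 0 < m) {w : E2 → ℝ}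
    (hw : ContinuousOn w (closedBox a ρ l s)) (hlap : ∀ x ∈ openBox a ρ l s, HasLap w x 0)
    (hnn : ∀ z ∈ closedBox a ρ l s, 0 ≤ w z)
    (hbot : ∀ z ∈ closedBox a ρ l s, z 1 = l → m ≤ w z) :
    ∃ κ > 0, ∀ t ∈ Ioo 0 (s - l), κ * t ≤ w !₂[a, s - t] := by
  set μ := π / (2 * ρ) with hμ
  have hμpos : 0 < μ := by positivity
  have hsh : 0 < Real.sinh (μ * (s - l)) := Real.sinh_pos_iff.2 (by nlinarith)
  set k := m / Real.sinh (μ * (s - l)) with hk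
  have hkpos : 0 < k := by positivity
  set f : ℝ → ℝ := fun x => Real.cos (μ * (x - a)) with hf
  set h : ℝ → ℝ := fun y => Real.sinh (μ * (s - y)) with hh
  have dl (t : ℝ) : HasDerivAt (fun x => μ * (x - a)) μ t := by
    simpa using ((hasDerivAt_id t).sub_const a).const_mul μ
  have dr (t : ℝ) : HasDerivAt (fun y => μ * (s - y)) (-μ) t := by
    simpa using ((hasDerivAt_id t).const_sub s).const_mul μ
  have hB (x : E2) : HasLap (fun z : E2 => f (z 0) * h (z 1)) x 0 := by
    refine (hasLap_mul_coord (f := f) (h := h) (f' := fun x => -Real.sin (μ * (x - a)) * μ)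
      (f'' := fun x => -(Real.cos (μ * (x - a)) * μ) * μ)
      (h' := fun y => Real.cosh (μ * (s - y)) * (-μ))
      (h'' := fun y => Real.sinh (μ * (s - y)) * (-μ) * (-μ)) ?_ ?_ (fun t => (dl t).cos)
      (fun t => ((dl t).sin.neg).mul_const μ) (fun t => (dr t).sinh)
      (fun t => ((dr t).cosh).mul_const (-μ)) x).congr_val ?_
    · fun_prop
    · exact Real.contDiff_sinh.comp (by fun_prop)
    · simp only [hf, hh]; ring
  have hmain := box_min (a := a) (ρ := ρ) (l := l) (s := s)
    (g := fun z => w z - k * (f (z 0) * h (z 1))) (hw.sub ?_) ?_ ?_ ?_ ?_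
  · refine ⟨k * μ, by positivity, fun t ht => ?_⟩
    have := hmain !₂[a, s - t] ⟨by simpa using hρ, by simp; linarith [ht.2], by simp [ht.1]⟩
    simp only [hf, hh, Matrix.cons_val_zero, Matrix.cons_val_one, sub_self,
      mul_zero, Real.cos_zero, one_mul, sub_sub_cancel] at this
    have h2 : μ * t ≤ Real.sinh (μ * t) := Real.self_le_sinh_iff.2 (by nlinarith [ht.1])
    have h3 : k * (μ * t) ≤ k * Real.sinh (μ * t) := by gcongr
    linarith
  · have : Continuous h := Real.continuous_sinh.comp (by fun_prop)
    exact Continuous.continuousOn (by fun_prop)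
  · exact fun x hx => ⟨0, le_rfl, ((hlap x hx).sub ((hB x).const_mul k)).congr_val (by simp)⟩
  · intro z hz hza
    have : f (z 0) = 0 := by
      simp only [hf]
      rw [← Real.cos_abs, abs_mul, hza, abs_of_pos hμpos]
      have : μ * ρ = π / 2 := by rw [hμ]; field_simp
      rw [this, Real.cos_pi_div_two]
    simpa [this] using hnn z hz
  · intro z hz hzl
    have h1 := hbot z hz hzl
    have h2 : k * h (z 1) = m := by simp only [hh, hzl, hk]; field_simp
    have h3 : k * (f (z 0) * h (z 1)) = m * f (z 0) := by rw [← h2]; ring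
    have h4 : m * f (z 0) ≤ m * 1 := by
      gcongr; exact Real.cos_le_one _
    simp only [h3]; linarith
  · intro z hz hzs
    simpa [hh, hzs] using hnn z hz

/-- Reflection across the horizontal line at height `s`. -/
def flipAt (s : ℝ) (z : E2) : E2 := !₂[z 0, 2 * s - z 1]

/-- Reflection across the horizontal axis. -/
def flipIso : E2 ≃ₗᵢ[ℝ] E2 :=
  LinearIsometryEquiv.piLpCongrRight 2 fun i : Fin 2 =>
    if i = 0 then LinearIsometryEquiv.refl ℝ ℝ else LinearIsometryEquiv.neg ℝ

@[simp] lemma flipAt_zero (s : ℝ) (z : E2) : flipAt s z 0 = z 0 := rfl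

@[simp] lemma flipAt_one (s : ℝ) (z : E2) : flipAt s z 1 = 2 * s - z 1 := rfl

lemma E2.ext' {z w : E2} (h0 : z 0 = w 0) (h1 : z 1 = w 1) : z = w := by
  ext i; fin_cases i <;> assumption

lemma E2.eta (z : E2) : !₂[z 0, z 1] = z := E2.ext' rfl rfl

lemma flipAt_eq (s : ℝ) (z : E2) : flipAt s z = !₂[0, 2 * s] + flipIso z := by
  apply E2.ext'
  · simp [flipIso]
  · simp [flipIso]; ring

@[fun_prop] lemma continuous_flipAt (s : ℝ) : Continuous (flipAt s) := by
  have : flipAt s = fun z => !₂[0, 2 * s] + flipIso z := funext (flipAt_eq s)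
  rw [this]; fun_prop

lemma flipAt_of_eq {s : ℝ} {z : E2} (h : z 1 = s) : flipAt s z = z :=
  E2.ext' rfl (by simp [h]; ring)

lemma flipAt_mk (a s t : ℝ) : flipAt s !₂[a, t] = !₂[a, 2 * s - t] := rfl

lemma HasLap.comp_flipAt {g : E2 → ℝ} {s c : ℝ} {z : E2} (h : HasLap g (flipAt s z) c) :
    HasLap (fun y => g (flipAt s y)) z c := by
  simp only [flipAt_eq] at h ⊢
  exact h.comp_isometry _ _ _

lemma hasDerivAt_symm_diff {u : E2 → ℝ} {a s : ℝ} (hu : DifferentiableAt ℝ u !₂[a, s]) :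
    HasDerivAt (fun t => u !₂[a, s + t] - u !₂[a, s - t])
      (2 * fderiv ℝ u !₂[a, s] (EuclideanSpace.single 1 1)) 0 := by
  set e : E2 := EuclideanSpace.single 1 1
  have h1 : (fun t : ℝ => u !₂[a, s + t] - u !₂[a, s - t]) =
      fun t => u (!₂[a, s] + t • e) - u (!₂[a, s] + t • (-e)) := by
    ext t
    congr 2
    · exact E2.ext' (by simp [e]) (by simp [e])
    · exact E2.ext' (by simp [e]) (by simp [e]; ring)
  have hl (e : E2) : HasDerivAt (fun t : ℝ => u (!₂[a, s] + t • e)) (fderiv ℝ u !₂[a, s] e) 0 := by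
    have k : HasDerivAt (fun t : ℝ => !₂[a, s] + t • e) e 0 := by
      simpa using ((hasDerivAt_id (0:ℝ)).smul_const e).const_add !₂[a, s]
    have k2 : HasFDerivAt u (fderiv ℝ u !₂[a, s]) (!₂[a, s] + (0:ℝ) • e) := by
      simpa using hu.hasFDerivAt
    exact k2.comp_hasDerivAt 0 k
  rw [h1]
  convert! (hl e).sub (hl (-e)) using 1
  rw [map_neg]; ring

lemma le_deriv_of_linear_le {F : ℝ → ℝ} {F' κ η : ℝ} (hF : HasDerivAt F F' 0) (h0 : F 0 = 0)
    (hη : 0 < η) (h : ∀ t ∈ Ioo 0 η, κ * t ≤ F t) : κ ≤ F' := by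
  have h1 := hF.tendsto_slope_zero_right
  refine ge_of_tendsto h1 ?_
  filter_upwards [Ioo_mem_nhdsGT hη] with t ht
  have := h t ht
  simp only [zero_add, h0, sub_zero, smul_eq_mul]
  rw [inv_mul_eq_div, le_div_iff₀ ht.1]; exact this

/-- Moving planes: no critical point on the top of a cap which reflects into the domain. -/
lemma IsTorsion.fderiv_ne_zero_of_cap {V : Set E2} {u : E2 → ℝ} (h : IsTorsion V u)
    (hV : IsOpen V) (hb : Bornology.IsBounded V) {a s : ℝ} (hq : !₂[a, s] ∈ V)
    (hrefl : ∀ z ∈ closure V, z 1 < s → flipAt s z ∈ V) : fderiv ℝ u !₂[a, s] ≠ 0 := by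
  have e1 : Continuous fun z : E2 => z 1 := by fun_prop
  have ecol : Continuous fun y : ℝ => (!₂[a, y] : E2) := by fun_prop
  set w : E2 → ℝ := fun z => u (flipAt s z) - u z with hw
  set C : Set E2 := closure V ∩ {z | z 1 ≤ s} with hC
  have hflip : MapsTo (flipAt s) C (closure V) := by
    intro z hz
    rcases (show z 1 ≤ s from hz.2).lt_or_eq with h1 | h1
    · exact subset_closure (hrefl z hz.1 h1)
    · rw [flipAt_of_eq h1]; exact hz.1
  have hwc : ContinuousOn w C :=
    (h.1.comp (continuous_flipAt s).continuousOn hflip).sub (h.1.mono inter_subset_left)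
  set U : Set E2 := {z | z 1 < s} ∩ V with hU
  have hUo : IsOpen U := (isOpen_lt e1 continuous_const).inter hV
  have hUC : closure U ⊆ C := by
    refine closure_minimal (fun z hz => ⟨subset_closure hz.2, (show z 1 < s from hz.1).le⟩) ?_
    exact isClosed_closure.inter (isClosed_le e1 continuous_const)
  have hwlap : ∀ z ∈ U, HasLap w z 0 := fun z hz =>
    ((h.hasLap (hrefl z (subset_closure hz.2) hz.1)).comp_flipAt.sub (h.hasLap hz.2)).congr_val
      (by norm_num)
  have hwnn : ∀ z ∈ C, 0 ≤ w z := by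
    intro z hz
    rcases (show z 1 ≤ s from hz.2).lt_or_eq with h1 | h1
    · refine min_principle hUo (hb.subset inter_subset_right) (hwc.mono hUC)
        (fun x hx => ⟨0, le_rfl, hwlap x hx⟩) (fun x hx => ?_) z
        ((isOpen_lt e1 continuous_const).inter_closure ⟨h1, hz.1⟩)
      have hxC := hUC hx.1
      rcases (show x 1 ≤ s from hxC.2).lt_or_eq with h2 | h2
      · have hxV : x ∉ V := fun hxV => hx.2 (by rw [hUo.interior_eq]; exact ⟨h2, hxV⟩)
        have hxf : u x = 0 := h.2.2.2 x ⟨hxC.1, by rwa [hV.interior_eq]⟩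
        simp only [hw, hxf, sub_zero]
        exact h.nonneg hV hb (hflip hxC)
      · simp [hw, flipAt_of_eq h2]
    · simp [hw, flipAt_of_eq h1]
  -- first exit of the vertical ray pointing downwards
  set S : Set ℝ := {t | t ≤ s ∧ ∀ y ∈ Icc t s, !₂[a, y] ∈ V} with hS
  have hsS : s ∈ S := ⟨le_rfl, fun y hy => by rwa [le_antisymm hy.2 hy.1]⟩
  have hSb : BddBelow S := by
    obtain ⟨D, hD⟩ := hb.subset_closedBall 0
    refine ⟨-D, fun t ht => ?_⟩
    have h1 := hD (ht.2 t ⟨le_rfl, ht.1⟩)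
    rw [mem_closedBall_zero_iff] at h1
    have h2 := (PiLp.norm_apply_le (!₂[a, t] : E2) 1).trans h1
    simp only [Matrix.cons_val_one, Real.norm_eq_abs] at h2
    exact (abs_le.1 h2).1
  set τ := sInf S with hτ
  have hτs : τ ≤ s := csInf_le hSb hsS
  have hcol : ∀ y ∈ Ioc τ s, !₂[a, y] ∈ V := by
    intro y hy
    obtain ⟨t, htS, hty⟩ := exists_lt_of_csInf_lt ⟨s, hsS⟩ hy.1
    exact htS.2 y ⟨hty.le, hy.2⟩
  have hτV : !₂[a, τ] ∉ V := by
    intro hmem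
    obtain ⟨δ, hδ, hball⟩ := Metric.isOpen_iff.1 (hV.preimage ecol) τ hmem
    have : τ - δ / 2 ∈ S := by
      refine ⟨by linarith, fun y hy => ?_⟩
      rcases lt_or_ge τ y with h1 | h1
      · exact hcol y ⟨h1, hy.2⟩
      · exact hball (by rw [mem_ball, Real.dist_eq, abs_lt]; constructor <;> linarith [hy.1])
    linarith [csInf_le hSb this]
  have hτlt : τ < s := lt_of_le_of_ne hτs fun h' => hτV (by rwa [h'])
  have hcolt : Tendsto (fun y : ℝ => (!₂[a, y] : E2)) (𝓝[>] τ) (𝓝 !₂[a, τ]) :=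
    (ecol.tendsto τ).mono_left nhdsWithin_le_nhds
  have hev : ∀ᶠ y in 𝓝[>] τ, y ∈ Ioo τ s := Ioo_mem_nhdsGT hτlt
  have hbcl : !₂[a, τ] ∈ closure V :=
    mem_closure_of_tendsto hcolt (hev.mono fun y hy => hcol y ⟨hy.1, hy.2.le⟩)
  have hbC : !₂[a, τ] ∈ C := ⟨hbcl, hτs⟩
  have hwb : 0 < w !₂[a, τ] := by
    have h1 : u !₂[a, τ] = 0 := h.2.2.2 _ ⟨hbcl, by rwa [hV.interior_eq]⟩
    simp only [hw, h1, sub_zero]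
    exact h.pos hV hb (hrefl _ hbcl hτlt)
  obtain ⟨l, hl, hwl⟩ : ∃ l ∈ Ioo τ s, 0 < w !₂[a, l] := by
    have h1 : Tendsto (fun y : ℝ => (!₂[a, y] : E2)) (𝓝[>] τ) (𝓝[C] !₂[a, τ]) :=
      tendsto_nhdsWithin_iff.2 ⟨hcolt, hev.mono fun y hy =>
        ⟨subset_closure (hcol y ⟨hy.1, hy.2.le⟩), hy.2.le⟩⟩
    have h2 := ((hwc _ hbC).tendsto.comp h1).eventually (lt_mem_nhds hwb)
    obtain ⟨l, h3, h4⟩ := (hev.and h2).exists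
    exact ⟨l, h3, h4⟩
  obtain ⟨ρ₁, hρ₁, hbox⟩ : ∃ ρ > 0, closedBox a ρ l s ⊆ V := by
    obtain ⟨ρ, hρ, hsub⟩ := (isCompact_Icc (a := l) (b := s)).image ecol
      |>.exists_cthickening_subset_open hV (by
        rintro _ ⟨y, hy, rfl⟩
        exact hcol y ⟨hl.1.trans_le hy.1, hy.2⟩)
    refine ⟨ρ, hρ, fun z hz => hsub ?_⟩
    refine mem_cthickening_of_dist_le z !₂[a, z 1] ρ _ ⟨z 1, hz.2, rfl⟩ ?_
    refine abs_le_of_sq_le_sq' ?_ hρ.le |>.2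
    rw [dist_sq_coord]
    simpa using sq_le_sq' (abs_le.1 hz.1).1 (abs_le.1 hz.1).2
  have hlU : !₂[a, l] ∈ U := ⟨hl.2, hcol l ⟨hl.1, hl.2.le⟩⟩
  have hwat : ContinuousAt w !₂[a, l] := (hwlap _ hlU).1.continuousAt
  obtain ⟨ρ₂, hρ₂, hnear⟩ :=
    Metric.eventually_nhds_iff.1 (hwat.eventually (lt_mem_nhds (half_lt_self hwl)))
  set ρ := min ρ₁ (ρ₂ / 2) with hρ
  have hρpos : 0 < ρ := by positivity
  have hsubC : closedBox a ρ l s ⊆ C := fun z hz =>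
    ⟨subset_closure (hbox ⟨hz.1.trans (min_le_left _ _), hz.2⟩), hz.2.2⟩
  obtain ⟨κ, hκ, hgrow⟩ := hopf_box (a := a) hρpos hl.2 (half_pos hwl) (hwc.mono hsubC)
    (fun z hz => hwlap z ⟨hz.2.2, hbox ⟨hz.1.le.trans (min_le_left _ _), hz.2.1.le, hz.2.2.le⟩⟩)
    (fun z hz => hwnn z (hsubC hz)) (fun z hz hzl => (hnear (by
      have h1 : dist z !₂[a, l] ≤ ρ := by
        refine abs_le_of_sq_le_sq' ?_ hρpos.le |>.2
        rw [dist_sq_coord]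
        simpa [hzl] using sq_le_sq' (abs_le.1 hz.1).1 (abs_le.1 hz.1).2
      linarith [min_le_right ρ₁ (ρ₂ / 2)])).le)
  intro hcrit
  have hd := hasDerivAt_symm_diff ((h.2.1 _ hq).differentiableAt (by norm_num))
  have := le_deriv_of_linear_le hd (by simp) (sub_pos.2 hl.2) (κ := κ) fun t ht => by
    have := hgrow t ht
    simp only [hw, flipAt_mk] at this
    convert! this using 4
    ring_nf
  rw [hcrit] at this
  simp at this
  linarith

/-- No critical point close to a flat piece of the boundary, with explicit constants. -/
lemma IsTorsion.fderiv_ne_zero_of_edge {V : Set E2} {u : E2 → ℝ} (h : IsTorsion V u)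
    (hV : IsOpen V) (hb : Bornology.IsBounded V) {D R : ℝ} (hR : 0 < R)
    (hD : ∀ z ∈ V, 0 < z 1 ∧ z 1 < D) (hbox : openBox 0 (4 * R) 0 (4 * R) ⊆ V) {a s : ℝ}
    (ha : |a| ≤ R) (hs : 0 < s) (hsR : 2 * s ≤ R) (hsD : 2 * (R + D) * s ^ 2 < R ^ 3) :
    fderiv ℝ u !₂[a, s] ≠ 0 := by
  have e1 : Continuous fun z : E2 => z 1 := by fun_prop
  have hDcl : ∀ z ∈ closure V, 0 ≤ z 1 ∧ z 1 ≤ D := by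
    have hcl : IsClosed {z : E2 | 0 ≤ z 1 ∧ z 1 ≤ D} :=
      (isClosed_le continuous_const e1).inter (isClosed_le e1 continuous_const)
    exact closure_minimal (fun z hz => ⟨(hD z hz).1.le, (hD z hz).2.le⟩) hcl
  have habs := abs_le.1 ha
  have hboxcl : ∀ z : E2, |z 0| ≤ 2 * R → 0 ≤ z 1 → z 1 ≤ 2 * R → z ∈ closure V := by
    intro z h0 h1 h2
    have ht : Tendsto (fun t : ℝ => (!₂[z 0, z 1 + t] : E2)) (𝓝[>] 0) (𝓝 z) := by
      have : Continuous fun t : ℝ => (!₂[z 0, z 1 + t] : E2) := by fun_prop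
      have := this.tendsto 0
      rw [add_zero, E2.eta] at this
      exact this.mono_left nhdsWithin_le_nhds
    refine mem_closure_of_tendsto ht ?_
    filter_upwards [Ioo_mem_nhdsGT hR] with t ht
    refine hbox ⟨?_, ?_, ?_⟩
    · simpa using by linarith
    · simpa using by linarith [ht.1]
    · simpa using by linarith [ht.2]
  have hup : ∀ z ∈ closure V, u z ≤ D * z 1 / 2 := by
    intro z hz
    have := min_principle hV hb (g := fun z => (0 + 0 * z 0 + D / 2 * z 1 + 0 * z 0 ^ 2 +
      (-1 / 2) * z 1 ^ 2) - u z) (ContinuousOn.sub (by fun_prop) h.1)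
      (fun x hx => ⟨_, by norm_num,
        (hasLap_quadratic 0 0 (D / 2) 0 (-1 / 2) x).sub (h.hasLap hx)⟩)
      (fun x hx => by
        have k1 := hDcl x hx.1
        rw [h.2.2.2 x hx]
        nlinarith [mul_nonneg k1.1 (sub_nonneg.2 k1.2)]) z hz
    simp only at this
    nlinarith [sq_nonneg (z 1)]
  have hlow : ∀ x y : ℝ, |x| ≤ 2 * R → 0 ≤ y → y ≤ R → y * R / 4 ≤ u !₂[x, y] := by
    intro x y hx hy hyR
    have hx' := abs_le.1 hx
    have hball : ball (!₂[x, R] : E2) R ⊆ V := by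
      intro z hz
      rw [mem_ball] at hz
      have h2 : dist z !₂[x, R] ^ 2 < R ^ 2 := by gcongr
      rw [dist_sq_coord] at h2
      simp only [Matrix.cons_val_zero, Matrix.cons_val_one] at h2
      have h3 : |z 0 - x| < R := abs_lt_of_sq_lt_sq (by nlinarith [sq_nonneg (z 1 - R)]) hR.le
      have h4 : |z 1 - R| < R := abs_lt_of_sq_lt_sq (by nlinarith [sq_nonneg (z 0 - x)]) hR.le
      rw [abs_lt] at h3 h4
      refine hbox ⟨?_, by linarith, by linarith⟩
      rw [sub_zero, abs_lt]; constructor <;> linarith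
    have hdist : dist (!₂[x, y] : E2) !₂[x, R] ^ 2 = (y - R) ^ 2 := by
      rw [dist_sq_coord]; simp
    have hmem : (!₂[x, y] : E2) ∈ closedBall !₂[x, R] R := by
      rw [mem_closedBall]
      refine abs_le_of_sq_le_sq' ?_ hR.le |>.2
      rw [hdist]; nlinarith
    have := h.ge_disc hV hb hR hball hmem
    rw [hdist] at this
    nlinarith
  set A := R / 2 with hA
  set K := (A + D / 2) * s / R ^ 2 with hK
  have hDpos : 0 < D := by
    have := hD !₂[0, R] (hbox ⟨by simpa using hR, by simpa using hR, by simp; linarith⟩)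
    linarith [this.1, this.2]
  have hKnn : 0 ≤ K := by positivity
  have hKR : K * R ^ 2 = (A + D / 2) * s := by rw [hK]; field_simp
  have hκ : 0 < A - 2 * K * s := by
    have : 2 * K * s * R ^ 2 = (R + D) * s ^ 2 := by
      linear_combination 2 * s * hKR + s ^ 2 * hA * 2
    have h2 : 0 < (A - 2 * K * s) * R ^ 2 := by
      rw [sub_mul, this, hA]; nlinarith
    exact pos_of_mul_pos_left h2 (by positivity)
  set w : E2 → ℝ := fun z => u (flipAt s z) - u z with hw
  have hin : ∀ z ∈ closedBox a R 0 s, |z 0| ≤ 2 * R := by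
    intro z hz
    have := abs_le.1 hz.1
    rw [abs_le]; constructor <;> linarith
  have hcl : closedBox a R 0 s ⊆ closure V := fun z hz =>
    hboxcl z (hin z hz) hz.2.1 (by linarith [hz.2.2])
  have hclf : MapsTo (flipAt s) (closedBox a R 0 s) (closure V) := fun z hz =>
    hboxcl _ (hin z hz) (by simp; linarith [hz.2.2]) (by simp; linarith [hz.2.1])
  have hwc : ContinuousOn w (closedBox a R 0 s) :=
    (h.1.comp (continuous_flipAt s).continuousOn hclf).sub (h.1.mono hcl)
  have hwlap : ∀ z ∈ openBox a R 0 s, HasLap w z 0 := by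
    intro z hz
    have hz0 := hin z ⟨hz.1.le, hz.2.1.le, hz.2.2.le⟩
    have k1 : z ∈ V := hbox ⟨by simpa using by linarith, hz.2.1, by linarith [hz.2.2]⟩
    have k2 : flipAt s z ∈ V := hbox ⟨by simpa using by linarith,
      by simp; linarith [hz.2.2], by simp; linarith [hz.2.1]⟩
    exact ((h.hasLap k2).comp_flipAt.sub (h.hasLap k1)).congr_val (by norm_num)
  have hB (x : E2) : HasLap (fun z : E2 => A * (s - z 1) -
      K * ((z 0 - a) ^ 2 - z 1 ^ 2 + s ^ 2)) x 0 := by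
    convert! hasLap_quadratic (A * s - K * a ^ 2 - K * s ^ 2) (2 * K * a) (-A) (-K) K x using 1
    · ext z; ring
    · ring
  have hmain := box_min (a := a) (ρ := R) (l := 0) (s := s)
    (g := fun z => w z - (A * (s - z 1) - K * ((z 0 - a) ^ 2 - z 1 ^ 2 + s ^ 2)))
    (hwc.sub (by fun_prop))
    (fun x hx => ⟨0, le_rfl, ((hwlap x hx).sub (hB x)).congr_val (by simp)⟩)
    (fun z hz hza => by
      have k1 := hup z (hcl hz)
      have k2 := h.nonneg hV hb (hclf hz)
      have k3 : (z 0 - a) ^ 2 = R ^ 2 := by rw [← hza, sq_abs]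
      have k4 : D * z 1 ≤ D * s := by gcongr; exact hz.2.2
      have k5 : 0 ≤ K * (s ^ 2 - z 1 ^ 2) := by
        refine mul_nonneg hKnn ?_
        nlinarith [hz.2.1, hz.2.2]
      have k6 : 0 ≤ A * z 1 := mul_nonneg (by positivity) hz.2.1
      simp only [hw, k3]
      linarith [mul_sub A s (z 1), mul_add K (R ^ 2) (s ^ 2 - z 1 ^ 2)])
    (fun z hz hz0 => by
      have k1 := hup z (hcl hz)
      have k2 := hlow (z 0) (2 * s) (hin z hz) (by linarith) hsR
      have k3 : flipAt s z = !₂[z 0, 2 * s] := by simp [flipAt, hz0]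
      have k4 : 0 ≤ K * ((z 0 - a) ^ 2 - z 1 ^ 2 + s ^ 2) := by
        rw [hz0]; exact mul_nonneg hKnn (by nlinarith [sq_nonneg (z 0 - a)])
      simp only [hw, k3]
      rw [hz0] at k1 k4 ⊢
      rw [hA]; linarith)
    (fun z hz hzs => by
      simp only [hw, flipAt_of_eq hzs, hzs]
      have : 0 ≤ K * (z 0 - a) ^ 2 := mul_nonneg hKnn (sq_nonneg _)
      linarith)
  intro hcrit
  have hqV : !₂[a, s] ∈ V := hbox ⟨by simpa using by linarith, by simpa using hs,
    by simp; linarith⟩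
  have hd := hasDerivAt_symm_diff ((h.2.1 _ hqV).differentiableAt (by norm_num))
  have := le_deriv_of_linear_le hd (by simp) hs (κ := A - 2 * K * s) fun t ht => by
    have := hmain !₂[a, s - t] ⟨by simpa using hR, by simpa using ht.2, by simpa using ht.1⟩
    simp only [hw, flipAt_mk, Matrix.cons_val_zero, Matrix.cons_val_one, sub_self] at this
    have e : 2 * s - (s - t) = s + t := by ring
    rw [e] at this
    have : 0 ≤ K * t ^ 2 := mul_nonneg hKnn (sq_nonneg t)
    nlinarith
  rw [hcrit] at this
  simp at this
  linarith

/-- Interior gradient bound for bounded nonnegative harmonic functions. -/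
lemma fderiv_le_of_harmonic {w : E2 → ℝ} {a s ρ M : ℝ} (hρ : 0 < ρ)
    (hlap : ∀ z : E2, |z 0 - a| ≤ ρ → |z 1 - s| ≤ ρ → HasLap w z 0)
    (h0 : ∀ z : E2, |z 0 - a| ≤ ρ → |z 1 - s| ≤ ρ → 0 ≤ w z)
    (hM : ∀ z : E2, |z 0 - a| ≤ ρ → |z 1 - s| ≤ ρ → w z ≤ M) :
    fderiv ℝ w !₂[a, s] (EuclideanSpace.single 1 1) ≤ M / ρ := by
  have hin : ∀ z ∈ closedBox a ρ s (s + ρ), |z 1 - s| ≤ ρ ∧ |flipAt s z 1 - s| ≤ ρ := by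
    intro z hz
    have := hz.2
    simp only [flipAt_one, abs_le]
    refine ⟨⟨?_, ?_⟩, ?_, ?_⟩ <;> linarith
  have hlap' : ∀ z ∈ closedBox a ρ s (s + ρ), HasLap (fun z => w z - w (flipAt s z)) z 0 :=
    fun z hz => ((hlap z hz.1 (hin z hz).1).sub
      (hlap (flipAt s z) hz.1 (hin z hz).2).comp_flipAt).congr_val (by simp)
  set K := M / ρ ^ 2 with hK
  set L := 2 * M / ρ with hL
  have hKρ : K * ρ ^ 2 = M := by rw [hK]; field_simp
  have hLρ : L * ρ = 2 * M := by rw [hL]; field_simp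
  have hMnn : 0 ≤ M := (h0 !₂[a, s] (by simpa using hρ.le) (by simpa using hρ.le)).trans
    (hM _ (by simpa using hρ.le) (by simpa using hρ.le))
  have hKnn : 0 ≤ K := by positivity
  have hB (x : E2) : HasLap (fun z : E2 => K * ((z 0 - a) ^ 2 - (z 1 - s) ^ 2) +
      L * (z 1 - s)) x 0 := by
    convert! hasLap_quadratic (K * a ^ 2 - K * s ^ 2 - L * s) (-2 * K * a) (2 * K * s + L) K
      (-K) x using 1
    · ext z; ring
    · ring
  have hdiff : ∀ z ∈ closedBox a ρ s (s + ρ), w z - w (flipAt s z) ≤ M := fun z hz => by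
    have := hM z hz.1 (hin z hz).1
    have := h0 (flipAt s z) hz.1 (hin z hz).2
    linarith
  have hmain := box_min (a := a) (ρ := ρ) (l := s) (s := s + ρ)
    (g := fun z => (K * ((z 0 - a) ^ 2 - (z 1 - s) ^ 2) + L * (z 1 - s)) -
      (w z - w (flipAt s z)))
    (ContinuousOn.sub (by fun_prop) fun z hz => (hlap' z hz).1.continuousAt.continuousWithinAt)
    (fun x hx => ⟨0, le_rfl, ((hB x).sub
      (hlap' x ⟨hx.1.le, hx.2.1.le, hx.2.2.le⟩)).congr_val (by simp)⟩)
    (fun z hz hza => by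
      have k1 := hdiff z hz
      have k2 : (z 0 - a) ^ 2 = ρ ^ 2 := by rw [← hza, sq_abs]
      have k3 : K * (z 1 - s) * (ρ - (z 1 - s)) ≥ 0 :=
        mul_nonneg (mul_nonneg hKnn (by linarith [hz.2.1])) (by linarith [hz.2.2])
      have k4 : L = 2 * (K * ρ) := by rw [hL, hK]; field_simp
      have k5 : 0 ≤ K * ρ * (z 1 - s) := mul_nonneg (by positivity) (by linarith [hz.2.1])
      simp only [k2, k4]
      nlinarith)
    (fun z hz hzs => by
      simp only [flipAt_of_eq hzs, hzs]
      have : 0 ≤ K * (z 0 - a) ^ 2 := mul_nonneg hKnn (sq_nonneg _)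
      linarith)
    (fun z hz hzs => by
      have k1 := hdiff z hz
      have : 0 ≤ K * (z 0 - a) ^ 2 := mul_nonneg hKnn (sq_nonneg _)
      simp only [hzs, add_sub_cancel_left]
      linarith [mul_sub K ((z 0 - a) ^ 2) (ρ ^ 2)])
  have hd := hasDerivAt_symm_diff
    ((hlap !₂[a, s] (by simpa using hρ.le) (by simpa using hρ.le)).1.differentiableAt (by norm_num))
  have := le_deriv_of_linear_le hd.neg (by simp) hρ (κ := -L) fun t ht => by
    have := hmain !₂[a, s + t] ⟨by simpa using hρ, by simpa using ht.1, by simpa using ht.2⟩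
    simp only [flipAt_mk, Matrix.cons_val_zero, Matrix.cons_val_one, sub_self] at this
    have e : 2 * s - (s + t) = s - t := by ring
    rw [e] at this
    have : 0 ≤ K * t ^ 2 := mul_nonneg hKnn (sq_nonneg t)
    simp only [Pi.neg_apply]
    nlinarith
  have hL2 : L = 2 * (M / ρ) := by rw [hL]; ring
  linarith

/-- The rigid motion `z ↦ q + L z`. -/
def rigid (L : E2 ≃ₗᵢ[ℝ] E2) (q : E2) : E2 ≃ₜ E2 := L.toHomeomorph.trans (Homeomorph.addLeft q)

@[simp] lemma rigid_apply (L : E2 ≃ₗᵢ[ℝ] E2) (q z : E2) : rigid L q z = q + L z := rfl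

lemma dist_rigid (L : E2 ≃ₗᵢ[ℝ] E2) (q z w : E2) : dist (rigid L q z) (rigid L q w) = dist z w := by
  simp

lemma IsTorsion.comp_rigid {V : Set E2} {u : E2 → ℝ} (h : IsTorsion V u) (L : E2 ≃ₗᵢ[ℝ] E2)
    (q : E2) : IsTorsion (rigid L q ⁻¹' V) (fun z => u (q + L z)) := by
  have hl (z : E2) (hz : z ∈ rigid L q ⁻¹' V) : HasLap (fun z => u (q + L z)) z (-1) :=
    (h.hasLap hz).comp_isometry L q z
  refine ⟨?_, fun z hz => (hl z hz).1, fun z hz => ?_, fun z hz => ?_⟩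
  · rw [← Homeomorph.preimage_closure]
    exact h.1.comp (rigid L q).continuous.continuousOn (fun z hz => hz)
  · rw [← (hasLap_lap (hl z hz).1).2, (hl z hz).2]
  · rw [← Homeomorph.preimage_frontier] at hz
    exact h.2.2.2 _ hz

lemma fderiv_comp_rigid {u : E2 → ℝ} (L : E2 ≃ₗᵢ[ℝ] E2) (q z : E2)
    (hu : DifferentiableAt ℝ u (q + L z)) (e : E2) :
    fderiv ℝ (fun z => u (q + L z)) z e = fderiv ℝ u (q + L z) (L e) := by
  have h1 : HasFDerivAt (fun z => q + L z) (L.toContinuousLinearEquiv : E2 →L[ℝ] E2) z :=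
    L.toContinuousLinearEquiv.hasFDerivAt.const_add q
  have := HasFDerivAt.comp (g := u) z hu.hasFDerivAt h1
  have e1 : (u ∘ fun z => q + L z) = fun z => u (q + L z) := rfl
  rw [e1] at this
  rw [this.fderiv]; rfl

lemma isBounded_preimage_rigid {V : Set E2} (hb : Bornology.IsBounded V) (L : E2 ≃ₗᵢ[ℝ] E2)
    (q : E2) : Bornology.IsBounded (rigid L q ⁻¹' V) := by
  obtain ⟨C, hC⟩ := Metric.isBounded_iff.1 hb
  exact Metric.isBounded_iff.2 ⟨C, fun x hx y hy => by
    rw [← dist_rigid L q]; exact hC hx hy⟩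

lemma convex_preimage_rigid {V : Set E2} (hc : Convex ℝ V) (L : E2 ≃ₗᵢ[ℝ] E2)
    (q : E2) : Convex ℝ (rigid L q ⁻¹' V) := by
  have := (hc.translate_preimage_right q).linear_preimage L.toLinearEquiv.toLinearMap
  exact this

lemma exists_rotation {ν : E2} (hν : ‖ν‖ = 1) :
    ∃ L : E2 ≃ₗᵢ[ℝ] E2, L (EuclideanSpace.single 1 1) = ν ∧ ∀ z, inner ℝ (L z) ν = z 1 := by
  have hν2 : ν 0 ^ 2 + ν 1 ^ 2 = 1 := by
    have := EuclideanSpace.norm_sq_eq ν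
    rw [hν, Fin.sum_univ_two] at this
    simpa using this.symm
  let F : E2 →ₗᵢ[ℝ] E2 :=
    { toFun := fun z => !₂[z 0 * ν 1 + z 1 * ν 0, - z 0 * ν 0 + z 1 * ν 1]
      map_add' := fun x y => E2.ext' (by simp; ring) (by simp; ring)
      map_smul' := fun c x => E2.ext' (by simp; ring) (by simp; ring)
      norm_map' := fun z => by
        rw [EuclideanSpace.norm_eq, EuclideanSpace.norm_eq]
        congr 1
        simp [Fin.sum_univ_two]
        linear_combination (z 0 ^ 2 + z 1 ^ 2) * hν2 }
  have h1 : F.toLinearIsometryEquiv rfl (EuclideanSpace.single 1 1) = ν :=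
    E2.ext' (by simp [F]) (by simp [F])
  refine ⟨F.toLinearIsometryEquiv rfl, h1, fun z => ?_⟩
  have := (F.toLinearIsometryEquiv rfl).inner_map_map z (EuclideanSpace.single 1 1)
  rw [h1] at this
  exact this.trans (by simp [EuclideanSpace.inner_single_right])

lemma E2.abs_le_norm (z : E2) (i : Fin 2) : |z i| ≤ ‖z‖ := by
  simpa using PiLp.norm_apply_le z i

lemma E2.norm_le_add (z : E2) : ‖z‖ ≤ |z 0| + |z 1| := by
  refine abs_le_of_sq_le_sq' ?_ (by positivity) |>.2
  rw [EuclideanSpace.norm_sq_eq, Fin.sum_univ_two]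
  simp only [Real.norm_eq_abs]
  nlinarith [mul_nonneg (abs_nonneg (z 0)) (abs_nonneg (z 1))]

/-- Coordinate-free form of the moving plane lemma. -/
lemma IsTorsion.fderiv_ne_zero_of_reflect {V : Set E2} {u : E2 → ℝ} (h : IsTorsion V u)
    (hV : IsOpen V) (hb : Bornology.IsBounded V) {q ν : E2} (hν : ‖ν‖ = 1) (hq : q ∈ V)
    (hrefl : ∀ z ∈ closure V, inner ℝ (z - q) ν < 0 → z - (2 * inner ℝ (z - q) ν) • ν ∈ V) :
    fderiv ℝ u q ≠ 0 := by
  obtain ⟨L, hL, hLi⟩ := exists_rotation hν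
  have h0 : (!₂[0, 0] : E2) = 0 := E2.ext' rfl rfl
  intro hcrit
  refine (h.comp_rigid L q).fderiv_ne_zero_of_cap (hV.preimage (rigid L q).continuous)
    (isBounded_preimage_rigid hb L q) (a := 0) (s := 0) (by rw [h0]; simpa) ?_ ?_
  · intro z hz hz1
    rw [← Homeomorph.preimage_closure] at hz
    have := hrefl _ hz (by simpa [hLi] using hz1)
    have e : flipAt 0 z = z - (2 * z 1) • EuclideanSpace.single 1 1 :=
      E2.ext' (by simp) (by simp; ring)
    simp only [rigid_apply, add_sub_cancel_left, hLi] at this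
    simp only [mem_preimage, e, rigid_apply, map_sub, map_smul, hL]
    rwa [← add_sub_assoc]
  · rw [h0]
    ext e
    rw [fderiv_comp_rigid]
    · simp [hcrit]
    · simpa using (h.2.1 q hq).differentiableAt (by norm_num)

lemma fderiv_le_of_harmonic_ball {w : E2 → ℝ} {q ν : E2} {ρ M : ℝ} (hρ : 0 < ρ) (hν : ‖ν‖ = 1)
    (hlap : ∀ z ∈ closedBall q (2 * ρ), HasLap w z 0)
    (hw : ∀ z ∈ closedBall q (2 * ρ), 0 ≤ w z ∧ w z ≤ M) : fderiv ℝ w q ν ≤ M / ρ := by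
  obtain ⟨L, hL, -⟩ := exists_rotation hν
  have h0 : (!₂[0, 0] : E2) = 0 := E2.ext' rfl rfl
  have hin (z : E2) (h1 : |z 0 - 0| ≤ ρ) (h2 : |z 1 - 0| ≤ ρ) : q + L z ∈ closedBall q (2 * ρ) := by
    have := E2.norm_le_add z
    simp only [sub_zero] at h1 h2
    simp; linarith
  have := fderiv_le_of_harmonic (w := fun z => w (q + L z)) (a := 0) (s := 0) (M := M) hρ
    (fun z h1 h2 => (hlap _ (hin z h1 h2)).comp_isometry L q z)
    (fun z h1 h2 => (hw _ (hin z h1 h2)).1) (fun z h1 h2 => (hw _ (hin z h1 h2)).2)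
  rw [h0, fderiv_comp_rigid, hL] at this
  · simpa using this
  · simpa using (hlap q (mem_closedBall_self (by linarith))).1.differentiableAt (by norm_num)

/-- Torsion functions of open subsets of `Ω` which coincide with `Ω` near `p` have no critical
point near `p`. -/
def NoCriticalNear (Ω : Set E2) (p : E2) : Prop :=
  ∀ ρ > 0, ∃ η > 0, ∀ (V : Set E2) (u : E2 → ℝ), IsOpen V → V ⊆ Ω → Ω ∩ ball p ρ ⊆ V →
    IsTorsion V u → ∀ q ∈ V, dist q p < η → fderiv ℝ u q ≠ 0

lemma mem_closure_of_between {Ω : Set E2} (hΩc : Convex ℝ Ω) {a b : E2} (ha : a ∈ closure Ω)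
    (hb : b ∈ closure Ω) (ha1 : a 1 = 0) (hb1 : b 1 = 0) (hab : a 0 < b 0) {x : ℝ}
    (hax : a 0 ≤ x) (hxb : x ≤ b 0) : !₂[x, 0] ∈ closure Ω := by
  have h : 0 < b 0 - a 0 := by linarith
  have := hΩc.closure ha hb (a := (b 0 - x) / (b 0 - a 0)) (b := (x - a 0) / (b 0 - a 0))
    (div_nonneg (by linarith) h.le) (div_nonneg (by linarith) h.le) (by field_simp; ring)
  convert! this using 1
  refine E2.ext' ?_ (by simp [ha1, hb1])
  simp
  field_simp
  ring

lemma exists_openBox_subset {Ω : Set E2} (hΩo : IsOpen Ω) (hΩc : Convex ℝ Ω)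
    (hne : Ω.Nonempty) (hpos : ∀ z ∈ Ω, 0 < z 1) {a b : E2} (ha : a ∈ closure Ω)
    (hb : b ∈ closure Ω) (ha1 : a 1 = 0) (hb1 : b 1 = 0) (ha0 : a 0 < 0) (hb0 : 0 < b 0)
    {ρ : ℝ} (hρ : 0 < ρ) : ∃ R > 0, R ≤ ρ ∧ openBox 0 (4 * R) 0 (4 * R) ⊆ Ω := by
  obtain ⟨c, hc⟩ := hne
  have hc1 := hpos c hc
  set β := min (-a 0) (b 0) with hβ
  have hβpos : 0 < β := lt_min (by linarith) hb0
  set k := 1 + |c 0| / c 1 with hk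
  have hkpos : 0 < k := by positivity
  refine ⟨min ρ (min (c 1 / 8) (β / (8 * k))), by positivity, min_le_left _ _, ?_⟩
  set R := min ρ (min (c 1 / 8) (β / (8 * k)))
  have hR1 : R ≤ c 1 / 8 := (min_le_right _ _).trans (min_le_left _ _)
  have hR2 : 8 * k * R ≤ β := by
    have : R ≤ β / (8 * k) := (min_le_right _ _).trans (min_le_right _ _)
    rwa [le_div_iff₀' (by positivity)] at this
  rintro z ⟨hz0, hz1, hz2⟩
  rw [sub_zero] at hz0
  set t := z 1 / c 1 with ht
  have htc : t * c 1 = z 1 := by rw [ht]; field_simp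
  have ht0 : 0 < t := by positivity
  have ht1 : t < 1 / 2 := by rw [ht, div_lt_iff₀ hc1]; linarith
  have htpos : 0 < 1 - t := by linarith
  set x := (z 0 - t * c 0) / (1 - t) with hx
  have hxt : (1 - t) * x = z 0 - t * c 0 := by rw [hx]; field_simp
  have hxβ : |x| ≤ β := by
    rw [hx, abs_div, abs_of_pos htpos, div_le_iff₀ htpos]
    have k1 : |z 0 - t * c 0| ≤ |z 0| + t * |c 0| := by
      have := abs_sub (z 0) (t * c 0)
      rwa [abs_mul, abs_of_pos ht0] at this
    have k2 : t * |c 0| ≤ 4 * R * (|c 0| / c 1) := by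
      rw [ht, div_mul_eq_mul_div, mul_div_assoc]
      gcongr
    have k3 : |z 0| + t * |c 0| ≤ 4 * k * R := by rw [hk]; linarith
    nlinarith
  have hxa := abs_le.1 hxβ
  have hm := mem_closure_of_between hΩc ha hb ha1 hb1 (by linarith) (x := x)
    (by linarith [min_le_left (-a 0) (b 0)]) (by linarith [min_le_right (-a 0) (b 0)])
  have := hΩc.openSegment_closure_interior_subset_interior hm (hΩo.interior_eq.symm ▸ hc)
    ⟨1 - t, t, htpos, ht0, by ring, rfl⟩
  rw [hΩo.interior_eq] at this
  convert! this using 1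
  exact E2.ext' (by simp; linarith) (by simp; linarith)

lemma noCriticalNear_zero_of_edge {Ω : Set E2} (hΩo : IsOpen Ω) (hΩb : Bornology.IsBounded Ω)
    (hΩc : Convex ℝ Ω) (hne : Ω.Nonempty) (hpos : ∀ z ∈ Ω, 0 < z 1) {a b : E2}
    (ha : a ∈ closure Ω) (hb : b ∈ closure Ω) (hab : a ≠ b) (h0 : 0 ∈ openSegment ℝ a b) :
    NoCriticalNear Ω 0 := by
  intro ρ hρ
  have hcl : ∀ z ∈ closure Ω, 0 ≤ z 1 := fun z hz =>
    closure_minimal (fun z hz => (hpos z hz).le)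
      (isClosed_le continuous_const (by fun_prop : Continuous fun z : E2 => z 1)) hz
  have hbox : ∃ R > 0, R ≤ ρ / 8 ∧ openBox 0 (4 * R) 0 (4 * R) ⊆ Ω := by
    obtain ⟨α, β, hα, hβ, -, hz⟩ := h0
    have e0 : α * a 0 + β * b 0 = 0 := by simpa using congrArg (fun z : E2 => z 0) hz
    have e1 : α * a 1 + β * b 1 = 0 := by simpa using congrArg (fun z : E2 => z 1) hz
    have ha1 := hcl a ha
    have hb1 := hcl b hb
    have ha1' : a 1 = 0 := by
      by_contra h
      have : 0 < a 1 := lt_of_le_of_ne ha1 (Ne.symm h)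
      nlinarith [mul_pos hα this, mul_nonneg hβ.le hb1]
    have hb1' : b 1 = 0 := by
      by_contra h
      have : 0 < b 1 := lt_of_le_of_ne hb1 (Ne.symm h)
      nlinarith [mul_pos hβ this, mul_nonneg hα.le ha1]
    rcases lt_trichotomy (a 0) 0 with h | h | h
    · refine exists_openBox_subset hΩo hΩc hne hpos ha hb ha1' hb1' h ?_ (by positivity)
      by_contra! hb
      nlinarith
    · have : b 0 = 0 := by
        rw [h, mul_zero, zero_add] at e0
        exact (mul_eq_zero.1 e0).resolve_left hβ.ne'
      exact absurd (E2.ext' (h.trans this.symm) (ha1'.trans hb1'.symm)) hab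
    · refine exists_openBox_subset hΩo hΩc hne hpos hb ha hb1' ha1' ?_ h (by positivity)
      by_contra! hb
      nlinarith
  obtain ⟨R, hR, hRρ, hsub⟩ := hbox
  obtain ⟨C, hC⟩ := hΩb.subset_closedBall 0
  have hD (z : E2) (hz : z ∈ Ω) : z 1 < |C| + 1 := by
    have h1 : ‖z‖ ≤ C := by simpa using hC hz
    have := (le_abs_self _).trans (z.abs_le_norm 1)
    linarith [le_abs_self C]
  set D := |C| + 1
  have hDpos : 0 < D := by positivity
  obtain ⟨η, hη, hη'⟩ : ∃ η > 0, ∀ s : ℝ, 0 < s → s < η → 2 * (R + D) * s ^ 2 < R ^ 3 := by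
    have : Tendsto (fun s : ℝ => 2 * (R + D) * s ^ 2) (𝓝 0) (𝓝 0) := by
      have : Continuous (fun s : ℝ => 2 * (R + D) * s ^ 2) := by fun_prop
      simpa using this.tendsto 0
    obtain ⟨η, hη, h⟩ := Metric.eventually_nhds_iff.1
      (this.eventually_lt_const (by positivity : (0:ℝ) < R ^ 3))
    exact ⟨η, hη, fun s h0 hs => h (by rwa [Real.dist_eq, sub_zero, abs_of_pos h0])⟩
  refine ⟨min η (R / 2), by positivity, fun V u hV hVΩ hball hu q hq hqd => ?_⟩
  have hqn : ‖q‖ < min η (R / 2) := by simpa using hqd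
  have h1 := q.abs_le_norm 0
  have h2 := (le_abs_self _).trans (q.abs_le_norm 1)
  have := hu.fderiv_ne_zero_of_edge hV (hΩb.subset hVΩ) (D := D) (R := R) (a := q 0) (s := q 1) hR
    (fun z hz => ⟨hpos z (hVΩ hz), hD z (hVΩ hz)⟩) ?_ ?_ (hpos q (hVΩ hq)) ?_ ?_
  · rwa [E2.eta] at this
  · intro z hz
    refine hball ⟨hsub hz, ?_⟩
    have := z.norm_le_add
    have h4 := hz.1
    rw [sub_zero] at h4
    rw [mem_ball, dist_zero_right]
    have := abs_of_pos hz.2.1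
    linarith [hz.2.2]
  · linarith [min_le_right η (R / 2)]
  · linarith [min_le_right η (R / 2)]
  · exact hη' _ (hpos q (hVΩ hq)) (by linarith [min_le_left η (R / 2)])

lemma NoCriticalNear.of_preimage_rigid {Ω : Set E2} {L : E2 ≃ₗᵢ[ℝ] E2} {p : E2}
    (h : NoCriticalNear (rigid L p ⁻¹' Ω) 0) : NoCriticalNear Ω p := by
  intro ρ hρ
  obtain ⟨η, hη, H⟩ := h ρ hρ
  refine ⟨η, hη, fun V u hV hVΩ hball hu q hq hqd hcrit => ?_⟩
  obtain ⟨z, rfl⟩ := (rigid L p).surjective q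
  have e (z : E2) : dist (rigid L p z) p = dist z 0 := by simp
  refine H (rigid L p ⁻¹' V) _ (hV.preimage (rigid L p).continuous) (preimage_mono hVΩ) ?_
    (hu.comp_rigid L p) z hq (by rwa [e] at hqd) ?_
  · rintro w ⟨hw, hwb⟩
    exact hball ⟨hw, by rwa [mem_ball, e]⟩
  · ext v
    rw [fderiv_comp_rigid]
    · rw [rigid_apply] at hcrit
      simp [hcrit]
    · exact (hu.2.1 _ hq).differentiableAt (by norm_num)

/-- No critical points near a boundary point that is interior to a boundary segment. -/
lemma noCriticalNear_of_edge {Ω : Set E2} (hΩo : IsOpen Ω) (hΩb : Bornology.IsBounded Ω)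
    (hΩc : Convex ℝ Ω) (hne : Ω.Nonempty) {p ν : E2} (hν : ‖ν‖ = 1)
    (hpos : ∀ z ∈ Ω, 0 < inner ℝ (z - p) ν) {a b : E2}
    (ha : a ∈ closure Ω) (hb : b ∈ closure Ω) (hab : a ≠ b) (hp : p ∈ openSegment ℝ a b) :
    NoCriticalNear Ω p := by
  obtain ⟨L, -, hLi⟩ := exists_rotation hν
  obtain ⟨a, rfl⟩ := (rigid L p).surjective a
  obtain ⟨b, rfl⟩ := (rigid L p).surjective b
  refine NoCriticalNear.of_preimage_rigid (L := L) ?_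
  refine noCriticalNear_zero_of_edge (hΩo.preimage (rigid L p).continuous)
    (isBounded_preimage_rigid hΩb L p) (convex_preimage_rigid hΩc L p)
    (hne.preimage (rigid L p).surjective) (fun z hz => ?_) (a := a) (b := b) ?_ ?_
    (fun h => hab (by rw [h])) ?_
  · have := hpos _ hz
    simpa [hLi] using this
  · rwa [← Homeomorph.preimage_closure]
  · rwa [← Homeomorph.preimage_closure]
  · obtain ⟨α, β, hα, hβ, hαβ, hz⟩ := hp
    refine ⟨α, β, hα, hβ, hαβ, L.injective ?_⟩
    have : α • (p + L a) + β • (p + L b) = (α + β) • p + (α • L a + β • L b) := by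
      module
    simp only [rigid_apply, this, hαβ, one_smul, add_eq_left] at hz
    simpa using hz

lemma isCompact_convexJoin {A B : Set E2} (hA : IsCompact A) (hB : IsCompact B) :
    IsCompact (convexJoin ℝ A B) := by
  have h : convexJoin ℝ A B = (fun x : (E2 × E2) × ℝ => (1 - x.2) • x.1.1 + x.2 • x.1.2) ''
      ((A ×ˢ B) ×ˢ Icc 0 1) := by
    ext z
    simp only [mem_convexJoin, segment_eq_image, mem_image, Prod.exists, mem_prod]
    constructor
    · rintro ⟨a, ha, b, hb, t, ht, rfl⟩
      exact ⟨a, b, t, ⟨⟨ha, hb⟩, ht⟩, rfl⟩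
    · rintro ⟨a, b, t, ⟨⟨ha, hb⟩, ht⟩, rfl⟩
      exact ⟨a, ha, b, hb, t, ht, rfl⟩
  rw [h]
  exact ((hA.prod hB).prod isCompact_Icc).image (by fun_prop)

/-- A compact part of a convex set which misses an extreme point lies in a compact convex set
missing that point. -/
lemma exists_compact_convex_of_extreme {K S : Set E2} (hK : Convex ℝ K) (hKc : IsCompact K)
    {p : E2} (hp : p ∈ K.extremePoints ℝ) (hS : IsCompact S) (hSK : S ⊆ K) (hpS : p ∉ S) :
    ∃ C, IsCompact C ∧ Convex ℝ C ∧ S ⊆ C ∧ C ⊆ K ∧ p ∉ C := by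
  refine hS.induction_on (p := fun S => ∃ C, IsCompact C ∧ Convex ℝ C ∧ S ⊆ C ∧ C ⊆ K ∧ p ∉ C)
    ⟨∅, isCompact_empty, convex_empty, by simp⟩ ?_ ?_ ?_
  · rintro s t hst ⟨C, h1, h2, h3, h4⟩
    exact ⟨C, h1, h2, hst.trans h3, h4⟩
  · rintro s t ⟨C, hC, hCc, hsC, hCK, hpC⟩ ⟨D, hD, hDc, htD, hDK, hpD⟩
    rcases C.eq_empty_or_nonempty with rfl | hCn
    · rw [subset_empty_iff.1 hsC, empty_union]
      exact ⟨D, hD, hDc, htD, hDK, hpD⟩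
    rcases D.eq_empty_or_nonempty with rfl | hDn
    · rw [subset_empty_iff.1 htD, union_empty]
      exact ⟨C, hC, hCc, hsC, hCK, hpC⟩
    refine ⟨convexJoin ℝ C D, isCompact_convexJoin hC hD, hCc.convexJoin hDc,
      union_subset (hsC.trans (subset_convexJoin_left hDn))
        (htD.trans (subset_convexJoin_right hCn)), convexJoin_subset hCK hDK hK, fun h => ?_⟩
    obtain ⟨x, hx, y, hy, hxy⟩ := mem_convexJoin.1 h
    rcases (mem_extremePoints_iff_forall_segment.1 hp).2 x (hCK hx) y (hDK hy) hxy with h | h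
    · exact hpC (h ▸ hx)
    · exact hpD (h ▸ hy)
  · intro x hx
    have hd : 0 < dist p x := dist_pos.2 (fun h => hpS (h ▸ hx))
    refine ⟨K ∩ closedBall x (dist p x / 2), ?_, K ∩ closedBall x (dist p x / 2),
      hKc.inter_right isClosed_closedBall, hK.inter (convex_closedBall _ _), le_rfl,
      inter_subset_left, fun h => ?_⟩
    · exact inter_mem (mem_of_superset self_mem_nhdsWithin hSK)
        (mem_nhdsWithin_of_mem_nhds (closedBall_mem_nhds _ (by positivity)))
    · have := mem_closedBall.1 h.2
      linarith

/-- Reflecting a small cap into the domain. -/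
lemma fderiv_ne_zero_of_small_cap {Ω : Set E2} (hΩo : IsOpen Ω) (hΩb : Bornology.IsBounded Ω)
    (hΩc : Convex ℝ Ω) {p w : E2} {ρ δ s₀ : ℝ} (hδ : 0 < δ) (hδw : 3 * δ < ‖w‖)
    (hwρ : 2 * ‖w‖ ≤ ρ) (hball : closedBall (p + w) δ ⊆ Ω)
    (hcap : ∀ z ∈ closure Ω, inner ℝ (z - p) w ≤ s₀ → dist z p ≤ δ)
    {V : Set E2} {u : E2 → ℝ} (hV : IsOpen V) (hVΩ : V ⊆ Ω) (hVρ : Ω ∩ ball p ρ ⊆ V)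
    (hu : IsTorsion V u) {q : E2} (hq : q ∈ V) (hq1 : 3 * dist q p ≤ ‖w‖)
    (hq2 : dist q p * ‖w‖ ≤ s₀) : fderiv ℝ u q ≠ 0 := by
  have hw : 0 < ‖w‖ := by linarith
  set ν : E2 := ‖w‖⁻¹ • w with hν
  have hν1 : ‖ν‖ = 1 := by rw [hν, norm_smul, norm_inv, norm_norm, inv_mul_cancel₀ hw.ne']
  have hwν : w = ‖w‖ • ν := by rw [hν, smul_inv_smul₀ hw.ne']
  refine hu.fderiv_ne_zero_of_reflect hV (hΩb.subset hVΩ) hν1 hq fun z hz hzq => ?_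
  have hzΩ := closure_mono hVΩ hz
  set y := inner ℝ (z - p) ν with hy
  set s := inner ℝ (q - p) ν with hs
  have hsq : s ≤ dist q p := by
    have := real_inner_le_norm (q - p) ν
    rwa [hν1, mul_one, ← dist_eq_norm] at this
  have hzqs : inner ℝ (z - q) ν = y - s := by
    rw [hy, hs, ← inner_sub_left]; congr 1; abel
  rw [hzqs] at hzq ⊢
  have hzp : dist z p ≤ δ := by
    refine hcap z hzΩ ?_
    rw [hwν, inner_smul_right, ← hy]
    refine le_trans ?_ hq2
    rw [mul_comm]
    gcongr
    linarith
  have hyz : |y| ≤ δ := by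
    have := abs_real_inner_le_norm (z - p) ν
    rw [hν1, mul_one, ← dist_eq_norm] at this
    exact this.trans hzp
  have hy2 := abs_le.1 hyz
  have hm : z + (‖w‖ - y) • ν ∈ Ω := by
    refine hball ?_
    rw [mem_closedBall, dist_eq_norm]
    have e : z + (‖w‖ - y) • ν - (p + w) = (z - p) - y • ν := by
      nth_rewrite 2 [hwν]; module
    rw [e]
    refine le_trans ?_ hzp
    rw [dist_eq_norm]
    refine abs_le_of_sq_le_sq' ?_ (norm_nonneg _) |>.2
    rw [norm_sub_sq_real, inner_smul_right, ← hy, norm_smul, hν1, Real.norm_eq_abs, mul_one, sq_abs]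
    nlinarith [sq_nonneg y]
  have hden : 0 < ‖w‖ - y := by linarith
  set τ := 2 * (s - y) / (‖w‖ - y) with hτ
  have hτy : τ * (‖w‖ - y) = 2 * (s - y) := by rw [hτ]; field_simp
  have hτ0 : 0 < τ := div_pos (by linarith) hden
  have hτ1 : τ < 1 := by rw [hτ, div_lt_one hden]; linarith
  have := hΩc.openSegment_closure_interior_subset_interior hzΩ (hΩo.interior_eq.symm ▸ hm)
    ⟨1 - τ, τ, by linarith, hτ0, by ring, rfl⟩
  rw [hΩo.interior_eq] at this
  have e : (1 - τ) • z + τ • (z + (‖w‖ - y) • ν) = z - (2 * (y - s)) • ν := by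
    have : τ • (z + (‖w‖ - y) • ν) = τ • z + (τ * (‖w‖ - y)) • ν := by module
    rw [this, hτy]; module
  rw [e] at this
  refine hVρ ⟨this, ?_⟩
  have e2 : z - (2 * (y - s)) • ν - p = (z - p) + (2 * (s - y)) • ν := by module
  have e3 := norm_add_le (z - p) ((2 * (s - y)) • ν)
  rw [norm_smul, hν1, mul_one, Real.norm_eq_abs, abs_of_pos (by linarith), ← dist_eq_norm] at e3
  rw [mem_ball, dist_eq_norm, e2]
  linarith

/-- Among the inner normals at a boundary point there is one which points into the domain. -/
lemma exists_normal_pointing_inside {Ω : Set E2} (hΩo : IsOpen Ω) (hΩc : Convex ℝ Ω)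
    (hne : Ω.Nonempty) (p : E2) :
    ∃ w, p + w ∈ Ω ∧ ∀ z ∈ Ω, 0 ≤ inner ℝ (z - p) w := by
  by_contra! hcon
  set N : Set E2 := {w | ∀ z ∈ Ω, 0 ≤ inner ℝ (z - p) w}
  have hN : Convex ℝ N := by
    intro x hx y hy a b ha hb _ z hz
    rw [inner_add_right, inner_smul_right, inner_smul_right]
    exact add_nonneg (mul_nonneg ha (hx z hz)) (mul_nonneg hb (hy z hz))
  obtain ⟨f, s, hf, hs⟩ := geometric_hahn_banach_open (hΩc.translate_preimage_right p)
    (hΩo.preimage (by fun_prop : Continuous fun z => p + z)) hN (by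
      rw [Set.disjoint_left]
      intro w hw hwN
      obtain ⟨z, hz, h⟩ := hcon w hw
      exact absurd (hwN z hz) (not_le.2 h))
  have hs0 : s ≤ 0 := by simpa using hs 0 (fun z _ => by simp)
  set v : E2 := (InnerProductSpace.toDual ℝ E2).symm f with hv
  have hfv (z : E2) : f z = inner ℝ z v := by
    rw [real_inner_comm, hv, InnerProductSpace.toDual_symm_apply]
  have hneg (z : E2) (hz : z ∈ Ω) : f (z - p) < 0 := (hf (z - p) (by simpa using hz)).trans_le hs0
  have hvN (k : ℝ) (hk : 0 ≤ k) : -(k • v) ∈ N := by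
    intro z hz
    rw [inner_neg_right, inner_smul_right, ← hfv]
    nlinarith [hneg z hz]
  have hv0 : v ≠ 0 := by
    intro h
    obtain ⟨z, hz⟩ := hne
    have := hneg z hz
    rw [hfv, h, inner_zero_right] at this
    exact lt_irrefl _ this
  have hvp : 0 < ‖v‖ ^ 2 := by have := norm_pos_iff.2 hv0; positivity
  have := hs _ (hvN ((1 - s) / ‖v‖ ^ 2) (by apply div_nonneg <;> linarith))
  rw [hfv, inner_neg_left, inner_smul_left, real_inner_self_eq_norm_sq] at this
  simp only [conj_trivial] at this
  rw [div_mul_cancel₀ _ hvp.ne'] at this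
  linarith

lemma noCriticalNear_of_extreme {Ω : Set E2} (hΩo : IsOpen Ω) (hΩb : Bornology.IsBounded Ω)
    (hΩc : Convex ℝ Ω) {p : E2} (hpΩ : p ∉ Ω) (hp : p ∈ (closure Ω).extremePoints ℝ) :
    NoCriticalNear Ω p := by
  intro ρ hρ
  have hne : Ω.Nonempty := closure_nonempty_iff.1 ⟨p, hp.1⟩
  obtain ⟨w₀, hw₀, hw₀N, hw₀ρ⟩ : ∃ w, p + w ∈ Ω ∧ (∀ z ∈ Ω, 0 ≤ inner ℝ (z - p) w) ∧
      4 * ‖w‖ ≤ ρ := by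
    obtain ⟨w, hw, hwN⟩ := exists_normal_pointing_inside hΩo hΩc hne p
    have hw0 : 0 ≤ ‖w‖ := norm_nonneg w
    set t := min (1 / 2) (ρ / (4 * (‖w‖ + 1))) with ht
    have ht0 : 0 < t := by positivity
    have ht1 : t ≤ 1 / 2 := min_le_left _ _
    refine ⟨t • w, ?_, fun z hz => ?_, ?_⟩
    · have := hΩc.openSegment_closure_interior_subset_interior hp.1 (hΩo.interior_eq.symm ▸ hw)
        ⟨1 - t, t, by linarith, ht0, by ring, rfl⟩
      rw [hΩo.interior_eq] at this
      convert! this using 1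
      module
    · rw [inner_smul_right]; exact mul_nonneg ht0.le (hwN z hz)
    · have : t ≤ ρ / (4 * (‖w‖ + 1)) := min_le_right _ _
      rw [le_div_iff₀ (by positivity)] at this
      rw [norm_smul, Real.norm_eq_abs, abs_of_pos ht0]
      linarith
  have hw₀pos : 0 < ‖w₀‖ := norm_pos_iff.2 (by rintro rfl; exact hpΩ (by simpa using hw₀))
  obtain ⟨r, hr, hball⟩ := Metric.isOpen_iff.1 hΩo _ hw₀
  set δ := min (r / 3) (‖w₀‖ / 5) with hδ
  have hδpos : 0 < δ := by positivity
  have hδ1 : δ ≤ r / 3 := min_le_left _ _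
  have hδ2 : δ ≤ ‖w₀‖ / 5 := min_le_right _ _
  have hcomp : IsCompact (closure Ω) := hΩb.isCompact_closure
  obtain ⟨C, hC, hCc, hSC, -, hpC⟩ := exists_compact_convex_of_extreme hΩc.closure hcomp hp
    (hcomp.diff isOpen_ball) sdiff_subset (fun h => h.2 (mem_ball_self hδpos))
  obtain ⟨f, c, hfp, hfC⟩ := geometric_hahn_banach_point_closed hCc hC.isClosed hpC
  set v : E2 := (InnerProductSpace.toDual ℝ E2).symm f with hv
  have hfv (z : E2) : inner ℝ z v = f z := by
    rw [real_inner_comm, hv, InnerProductSpace.toDual_symm_apply]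
  set t := δ / (‖v‖ + 1) with ht
  have htpos : 0 < t := by positivity
  have htv : ‖t • v‖ ≤ δ := by
    rw [norm_smul, Real.norm_eq_abs, abs_of_pos htpos, ht, div_mul_eq_mul_div,
      div_le_iff₀ (by positivity)]
    nlinarith [norm_nonneg v]
  set w := w₀ + t • v with hw
  have hww : |‖w‖ - ‖w₀‖| ≤ δ := by
    refine (abs_norm_sub_norm_le _ _).trans ?_
    simpa [hw] using htv
  have hww' := abs_le.1 hww
  have hwpos : 0 < ‖w‖ := by linarith
  have hcl : ∀ z ∈ closure Ω, 0 ≤ inner ℝ (z - p) w₀ := fun z hz =>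
    closure_minimal hw₀N (isClosed_le continuous_const
      (by fun_prop : Continuous fun z => inner ℝ (z - p) w₀)) hz
  have hs : 0 < t * (c - f p) := mul_pos htpos (by linarith)
  refine ⟨min (‖w‖ / 3) (t * (c - f p) / ‖w‖), by positivity,
    fun V u hV hVΩ hVρ hu q hq hqd => ?_⟩
  have hq1 := hqd.le.trans (min_le_left _ _)
  have hq2 := hqd.le.trans (min_le_right _ _)
  rw [le_div_iff₀ hwpos] at hq2
  refine fderiv_ne_zero_of_small_cap hΩo hΩb hΩc (δ := δ) (w := w) hδpos (by linarith)
    (ρ := ρ) (by linarith) ?_ ?_ hV hVΩ hVρ hu hq (by linarith) hq2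
  · intro z hz
    apply hball
    rw [mem_closedBall] at hz
    rw [mem_ball]
    have : dist (p + w) (p + w₀) ≤ δ := by simpa [hw, dist_eq_norm] using htv
    linarith [dist_triangle z (p + w) (p + w₀)]
  · intro z hz hzs
    by_contra! hcon
    have h1 := hfC z (hSC ⟨hz, fun h => by linarith [mem_ball.1 h]⟩)
    rw [hw, inner_add_right, inner_smul_right, hfv, map_sub] at hzs
    have h2 := hcl z hz
    nlinarith

/-- No critical points near the boundary of a convex domain. -/
lemma noCriticalNear_of_mem_frontier {Ω : Set E2} (hΩo : IsOpen Ω)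
    (hΩb : Bornology.IsBounded Ω) (hΩc : Convex ℝ Ω) {p : E2} (hp : p ∈ frontier Ω) :
    NoCriticalNear Ω p := by
  have hpΩ : p ∉ Ω := (hΩo.frontier_eq ▸ hp).2
  have hpc : p ∈ closure Ω := frontier_subset_closure hp
  have hne : Ω.Nonempty := closure_nonempty_iff.1 ⟨p, hpc⟩
  by_cases hext : p ∈ (closure Ω).extremePoints ℝ
  · exact noCriticalNear_of_extreme hΩo hΩb hΩc hpΩ hext
  rw [mem_extremePoints_iff_left] at hext
  push Not at hext
  obtain ⟨a, ha, b, hb, hab, hap⟩ := hext hpc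
  obtain ⟨f, hf⟩ := geometric_hahn_banach_point_open hΩc hΩo hpΩ
  set v : E2 := (InnerProductSpace.toDual ℝ E2).symm f with hv
  have hfv (z : E2) : inner ℝ z v = f z := by
    rw [real_inner_comm, hv, InnerProductSpace.toDual_symm_apply]
  have hv0 : 0 < ‖v‖ := by
    refine norm_pos_iff.2 fun h => ?_
    obtain ⟨z, hz⟩ := hne
    have := hf z hz
    rw [← hfv, ← hfv, h] at this
    simp at this
  refine noCriticalNear_of_edge hΩo hΩb hΩc hne (ν := ‖v‖⁻¹ • v) ?_ (fun z hz => ?_) ha hb ?_ hab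
  · rw [norm_smul, norm_inv, norm_norm, inv_mul_cancel₀ hv0.ne']
  · rw [inner_smul_right, hfv, map_sub]
    exact mul_pos (inv_pos.2 hv0) (by linarith [hf z hz])
  · rintro rfl
    simp only [openSegment_same, mem_singleton_iff] at hab
    exact hap hab.symm

lemma hasLap_log_dist {x₀ z : E2} (hz : z ≠ x₀) :
    HasLap (fun y => Real.log (dist y x₀ ^ 2)) z 0 := by
  have h := (hasLap_log (x := -x₀ + z) (by rwa [neg_add_eq_sub, sub_ne_zero])).comp_isometry
    (LinearIsometryEquiv.refl ℝ E2) (-x₀) z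
  convert! h using 1
  ext y
  rw [dist_sq_coord]
  simp only [LinearIsometryEquiv.coe_refl, id, PiLp.add_apply, PiLp.neg_apply]
  congr 1; ring

/-- Effect of a small hole on the torsion function, by comparison with a logarithm. -/
lemma IsTorsion.sub_hole_bounds {Ω : Set E2} (hΩo : IsOpen Ω) (hΩb : Bornology.IsBounded Ω)
    {u₀ u : E2 → ℝ} (h₀ : IsTorsion Ω u₀) {x₀ : E2} {ε R M : ℝ} (hε : 0 < ε) (hεR : ε < R)
    (hu : IsTorsion (Ω \ closedBall x₀ ε) u) (hR : closure Ω ⊆ closedBall x₀ R)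
    (hM : ∀ z ∈ closure Ω, u₀ z ≤ M) {z : E2} (hz : z ∈ Ω \ closedBall x₀ ε) :
    HasLap (fun z => u₀ z - u z) z 0 ∧ 0 ≤ u₀ z - u z ∧
      u₀ z - u z ≤ M / (Real.log (R ^ 2) - Real.log (ε ^ 2)) *
        (Real.log (R ^ 2) - Real.log (dist z x₀ ^ 2)) := by
  set V := Ω \ closedBall x₀ ε with hVdef
  have hV : IsOpen V := hΩo.sdiff isClosed_closedBall
  have hVb : Bornology.IsBounded V := hΩb.subset sdiff_subset
  have hcl : closure V ⊆ closure Ω := closure_mono sdiff_subset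
  have hw : ∀ z ∈ V, HasLap (fun z => u₀ z - u z) z 0 := fun z hz =>
    ((h₀.hasLap hz.1).sub (hu.hasLap hz)).congr_val (by norm_num)
  have hwc : ContinuousOn (fun z => u₀ z - u z) (closure V) := (h₀.1.mono hcl).sub hu.1
  have hΛ : 0 < Real.log (R ^ 2) - Real.log (ε ^ 2) :=
    sub_pos.2 (Real.log_lt_log (by positivity) (by gcongr))
  set Λ := Real.log (R ^ 2) - Real.log (ε ^ 2) with hΛdef
  have hMnn : 0 ≤ M := (h₀.nonneg hΩo hΩb (subset_closure hz.1)).trans (hM _ (subset_closure hz.1))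
  have hfar : ∀ z ∈ closure V, ε ≤ dist z x₀ := fun z hz =>
    closure_minimal (fun z hz => (show ε < dist z x₀ from not_le.1 hz.2).le : V ⊆ {z | ε ≤ dist z x₀})
      (isClosed_le continuous_const (by fun_prop : Continuous fun z => dist z x₀)) hz
  have hlog : ∀ z ∈ closure V, Real.log (dist z x₀ ^ 2) ≤ Real.log (R ^ 2) := fun z hz => by
    have h1 := hfar z hz
    have h2 := mem_closedBall.1 (hR (hcl hz))
    exact Real.log_le_log (by have := hε.trans_le h1; positivity) (by gcongr)
  have hfr : ∀ z ∈ frontier V, u₀ z = 0 ∨ dist z x₀ = ε := by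
    intro z hz
    rcases frontier_inter_subset Ω (closedBall x₀ ε)ᶜ hz with h | h
    · exact Or.inl (h₀.2.2.2 z h.1)
    · rw [frontier_compl, frontier_closedBall _ hε.ne'] at h
      exact Or.inr h.2
  refine ⟨hw z hz, ?_, ?_⟩
  · refine min_principle hV hVb hwc (fun x hx => ⟨0, le_rfl, hw x hx⟩) (fun x hx => ?_) z
      (subset_closure hz)
    rw [hu.2.2.2 x hx, sub_zero]
    exact h₀.nonneg hΩo hΩb (hcl (frontier_subset_closure hx))
  · have hne : ∀ z ∈ closure V, dist z x₀ ^ 2 ≠ 0 := fun z hz =>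
      pow_ne_zero 2 (hε.trans_le (hfar z hz)).ne'
    have := min_principle hV hVb
      (g := fun z => M / Λ * (Real.log (R ^ 2) - Real.log (dist z x₀ ^ 2)) - (u₀ z - u z))
      ?_ ?_ ?_ z (subset_closure hz)
    · linarith
    · refine ContinuousOn.sub (continuousOn_const.mul (continuousOn_const.sub ?_)) hwc
      exact ContinuousOn.log (by fun_prop) hne
    · intro x hx
      have hx0 : x ≠ x₀ := by
        rintro rfl
        exact hne x (subset_closure hx) (by simp)
      exact ⟨_, by norm_num, (((hasLap_const (Real.log (R ^ 2)) x).sub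
        (hasLap_log_dist hx0)).const_mul (M / Λ)).sub (hw x hx)⟩
    · intro x hx
      have hxc := frontier_subset_closure hx
      rw [hu.2.2.2 x hx, sub_zero]
      rcases hfr x hx with h | h
      · rw [h, sub_zero]
        exact mul_nonneg (by positivity) (sub_nonneg.2 (hlog x hxc))
      · rw [h, ← hΛdef, div_mul_cancel₀ _ hΛ.ne']
        exact sub_nonneg.2 (hM x (hcl hxc))

/-- A small hole does not create critical points near a regular point of the torsion function. -/
lemma eventually_fderiv_ne_zero_of_interior {Ω : Set E2} (hΩo : IsOpen Ω)
    (hΩb : Bornology.IsBounded Ω) {u₀ : E2 → ℝ} (h₀ : IsTorsion Ω u₀) {x₀ p : E2} (hp : p ∈ Ω)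
    (hpx : p ≠ x₀) (hcrit : fderiv ℝ u₀ p ≠ 0) {ε₁ : ℝ} {uε : ℝ → E2 → ℝ}
    (huε : ∀ ε ∈ Ioo (0 : ℝ) ε₁, IsTorsion (Ω \ closedBall x₀ ε) (uε ε)) :
    ∀ᶠ x : ℝ × E2 in 𝓝 (0, p), x.1 ∈ Ioo 0 ε₁ → x.2 ∈ Ω \ closedBall x₀ x.1 →
      fderiv ℝ (uε x.1) x.2 ≠ 0 := by
  obtain ⟨M, hM⟩ : ∃ M, ∀ z ∈ closure Ω, u₀ z ≤ M := by
    obtain ⟨M, hM⟩ := (hΩb.isCompact_closure.image_of_continuousOn h₀.1).bddAbove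
    exact ⟨M, fun z hz => hM (mem_image_of_mem _ hz)⟩
  obtain ⟨R, hR0, hR⟩ : ∃ R > 0, closure Ω ⊆ closedBall x₀ R := by
    obtain ⟨R, hR⟩ := hΩb.isCompact_closure.isBounded.subset_closedBall x₀
    exact ⟨max R 1, by positivity, hR.trans (closedBall_subset_closedBall (le_max_left _ _))⟩
  have hd : 0 < dist p x₀ := dist_pos.2 hpx
  set d := dist p x₀
  obtain ⟨r, hr, hball⟩ := Metric.isOpen_iff.1 hΩo p hp
  set ρ := min (r / 4) (d / 6) with hρdef
  have hρ : 0 < ρ := by positivity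
  have hρ1 : ρ ≤ r / 4 := min_le_left _ _
  have hρ2 : ρ ≤ d / 6 := min_le_right _ _
  have hc : 0 < ‖fderiv ℝ u₀ p‖ := norm_pos_iff.2 hcrit
  set c := ‖fderiv ℝ u₀ p‖ / 2 with hcdef
  have hcont : ∀ᶠ q in 𝓝 p, c < ‖fderiv ℝ u₀ q‖ :=
    ((h₀.2.1 p hp).continuousAt_fderiv (by norm_num)).norm.eventually_const_lt (by linarith)
  set M' : ℝ → ℝ := fun ε => M / (Real.log (R ^ 2) - Real.log (ε ^ 2)) *
    (Real.log (R ^ 2) - Real.log ((d / 2) ^ 2)) with hM'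
  have hlim : ∀ᶠ ε in 𝓝[≠] (0 : ℝ), M' ε < c * ρ := by
    have h1 : Tendsto (fun ε : ℝ => Real.log (ε ^ 2)) (𝓝[≠] 0) atBot := by
      simp only [Real.log_pow]
      exact Real.tendsto_log_nhdsNE_zero.const_mul_atBot (by norm_num)
    have h2 : Tendsto (fun ε : ℝ => Real.log (R ^ 2) - Real.log (ε ^ 2)) (𝓝[≠] 0) atTop :=
      tendsto_atTop_add_const_left _ _ (tendsto_neg_atBot_atTop.comp h1)
    have h3 : Tendsto M' (𝓝[≠] 0) (𝓝 0) := by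
      have := ((tendsto_const_nhds (x := M)).div_atTop h2).mul_const
        (Real.log (R ^ 2) - Real.log ((d / 2) ^ 2))
      rwa [zero_mul] at this
    exact h3.eventually_lt_const (by positivity)
  rw [eventually_nhdsWithin_iff] at hlim
  have hε : ∀ᶠ ε in 𝓝 (0 : ℝ), (ε ≠ 0 → M' ε < c * ρ) ∧ ε < d / 2 ∧ ε < R :=
    hlim.and ((eventually_lt_nhds (by positivity)).and (eventually_lt_nhds hR0))
  have hq : ∀ᶠ q in 𝓝 p, c < ‖fderiv ℝ u₀ q‖ ∧ q ∈ ball p ρ :=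
    hcont.and (ball_mem_nhds p hρ)
  rw [nhds_prod_eq]
  filter_upwards [hε.prod_mk hq] with ⟨ε, q⟩ ⟨⟨h1, h2, h3⟩, h4, h5⟩ hε hqV hqc
  simp only at h1 h2 h3 h4 h5 hε hqV hqc
  have hu := huε ε hε
  have hin : ∀ z ∈ closedBall q (2 * ρ), z ∈ Ω \ closedBall x₀ ε ∧ d / 2 ≤ dist z x₀ := by
    intro z hz
    have k1 := mem_closedBall.1 hz
    have k2 := mem_ball.1 h5
    have k3 := dist_triangle z q p
    have k4 : d ≤ dist z p + dist z x₀ := dist_triangle_left p x₀ z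
    exact ⟨⟨hball (mem_ball.2 (by linarith)), fun h => by
      linarith [mem_closedBall.1 h]⟩, by linarith⟩
  have hlogR {x : ℝ} (hx : 0 < x) (hxR : x ≤ R) : Real.log (x ^ 2) ≤ Real.log (R ^ 2) :=
    Real.log_le_log (by positivity) (by gcongr)
  have hMnn : 0 ≤ M := (h₀.nonneg hΩo hΩb (subset_closure hp)).trans (hM _ (subset_closure hp))
  have hbd := fun z (hz : z ∈ closedBall q (2 * ρ)) =>
    IsTorsion.sub_hole_bounds hΩo hΩb h₀ hε.1 h3 hu hR hM (hin z hz).1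
  have hup : ∀ z ∈ closedBall q (2 * ρ), u₀ z - uε ε z ≤ M' ε := by
    intro z hz
    refine (hbd z hz).2.2.trans ?_
    have := hlogR hε.1 h3.le
    refine mul_le_mul_of_nonneg_left ?_ (div_nonneg hMnn (by linarith))
    have : Real.log ((d / 2) ^ 2) ≤ Real.log (dist z x₀ ^ 2) :=
      Real.log_le_log (by positivity) (by gcongr; exact (hin z hz).2)
    linarith
  have hd0 : DifferentiableAt ℝ u₀ q := (h₀.2.1 q hqV.1).differentiableAt (by norm_num)
  have hd1 : DifferentiableAt ℝ (uε ε) q := (hu.2.1 q hqV).differentiableAt (by norm_num)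
  set v : E2 := (InnerProductSpace.toDual ℝ E2).symm (fderiv ℝ u₀ q) with hv
  have hvn : ‖v‖ = ‖fderiv ℝ u₀ q‖ := by rw [hv, LinearIsometryEquiv.norm_map]
  have hvpos : 0 < ‖v‖ := by rw [hvn]; linarith
  have := fderiv_le_of_harmonic_ball (w := fun z => u₀ z - uε ε z) (ν := ‖v‖⁻¹ • v) (M := M' ε) hρ
    (by rw [norm_smul, norm_inv, norm_norm, inv_mul_cancel₀ hvpos.ne'])
    (fun z hz => (hbd z hz).1) (fun z hz => ⟨(hbd z hz).2.1, hup z hz⟩)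
  have hfd : fderiv ℝ (fun z => u₀ z - uε ε z) q = fderiv ℝ u₀ q := by
    have := fderiv_sub hd0 hd1
    rw [hqc, sub_zero] at this
    exact this
  have hvv : fderiv ℝ u₀ q v = ‖v‖ ^ 2 := by
    rw [← real_inner_self_eq_norm_sq, hv, InnerProductSpace.toDual_symm_apply]
  rw [hfd, map_smul, hvv, smul_eq_mul, le_div_iff₀ hρ, pow_two, inv_mul_cancel_left₀ hvpos.ne',
    hvn] at this
  have := h1 hε.1.ne'
  nlinarith

lemma gradient_eq_zero_iff {u : E2 → ℝ} {x : E2} : gradient u x = 0 ↔ fderiv ℝ u x = 0 := by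
  simp [gradient]

/-- If `x₀ = y₀`, then for small `ε` all critical points of `u_ε` lie within
distance `r` of `x₀`. -/
theorem critical_points_concentrate_at_x0
    (Ω : Set E2) (hΩo : IsOpen Ω) (hΩb : Bornology.IsBounded Ω) (hΩc : Convex ℝ Ω)
    (u₀ : E2 → ℝ) (h₀ : IsTorsion Ω u₀) (h₀pos : ∀ x ∈ Ω, 0 < u₀ x)
    (y₀ : E2) (hy₀ : y₀ ∈ Ω) (hy₀crit : gradient u₀ y₀ = 0)
    (hy₀uniq : ∀ x ∈ Ω, gradient u₀ x = 0 → x = y₀)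
    (hy₀max : IsMaxOn u₀ Ω y₀)
    (x₀ : E2) (hx₀ : x₀ ∈ Ω) (heq : x₀ = y₀)
    (ε₁ : ℝ) (hε₁ : 0 < ε₁) (hball : closedBall x₀ ε₁ ⊆ Ω)
    (uε : ℝ → E2 → ℝ)
    (huε : ∀ ε ∈ Ioo (0:ℝ) ε₁, IsTorsion (Ω \ closedBall x₀ ε) (uε ε)) :
    ∀ r > 0, ∃ ε₀ > 0, ε₀ ≤ ε₁ ∧ ∀ ε ∈ Ioo (0:ℝ) ε₀,
      ∀ x ∈ Ω \ closedBall x₀ ε, gradient (uε ε) x = 0 → ‖x - x₀‖ < r := by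
  intro r hr
  have hK : IsCompact (closure Ω \ ball x₀ r) := hΩb.isCompact_closure.diff isOpen_ball
  have hev : ∀ᶠ ε in 𝓝 (0 : ℝ), ∀ q ∈ closure Ω \ ball x₀ r, ε ∈ Ioo 0 ε₁ →
      q ∈ Ω \ closedBall x₀ ε → fderiv ℝ (uε ε) q ≠ 0 := by
    refine hK.eventually_forall_of_forall_eventually fun p hp => ?_
    have hpx : p ≠ x₀ := by rintro rfl; exact hp.2 (mem_ball_self hr)
    by_cases hpΩ : p ∈ Ω
    · refine eventually_fderiv_ne_zero_of_interior hΩo hΩb h₀ hpΩ hpx (fun h => hpx ?_) huε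
      rw [heq]
      exact hy₀uniq p hpΩ (gradient_eq_zero_iff.2 h)
    · have hpf : p ∈ frontier Ω := by rw [hΩo.frontier_eq]; exact ⟨hp.1, hpΩ⟩
      have hρ : 0 < dist p x₀ / 2 := half_pos (dist_pos.2 hpx)
      obtain ⟨η, hη, H⟩ := noCriticalNear_of_mem_frontier hΩo hΩb hΩc hpf _ hρ
      rw [nhds_prod_eq]
      filter_upwards [(eventually_lt_nhds hρ).prod_mk (ball_mem_nhds p hη)] with
        ⟨ε, q⟩ ⟨h1, h2⟩ hε hq
      refine H _ _ (hΩo.sdiff isClosed_closedBall) sdiff_subset ?_ (huε ε hε) q hq h2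
      rintro z ⟨hz, hzp⟩
      refine ⟨hz, fun h => ?_⟩
      have k1 := mem_closedBall.1 h
      have k2 := mem_ball.1 hzp
      simp only at h1 k1
      linarith [dist_triangle_left p x₀ z]
  obtain ⟨ε₂, hε₂, H⟩ := Metric.eventually_nhds_iff.1 hev
  refine ⟨min ε₁ ε₂, lt_min hε₁ hε₂, min_le_left _ _, fun ε hε x hx hxc => ?_⟩
  rw [← dist_eq_norm]
  by_contra! hcon
  exact H (by rw [Real.dist_eq, sub_zero, abs_of_pos hε.1]; exact hε.2.trans_le (min_le_right _ _))
    x ⟨subset_closure hx.1, fun h => not_le.2 (mem_ball.1 h) hcon⟩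
    ⟨hε.1, hε.2.trans_le (min_le_left _ _)⟩ hx (gradient_eq_zero_iff.1 hxc)
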